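/- arXiv:gr-qc/0612014 — 4 statements merged into one kernel-verified Lean document; each statement's English description precedes it below -/
import Mathlib

section
/- (Causal simplicity and the Bolza problem.) The following are equivalent: (A) the Eisenhart spacetime is causally simple, i.e. for every m ∈ M both J⁺(m) and J⁻(m) are closed subsets of M; (B) both of the following hold: (i) the function 𝓘 is lower semicontinuous on (ℝ×ℝ^d) × (ℝ×ℝ^d), and (ii) whenever t₀ < t₁ and 𝓘((t₀,q₀),(t₁,q₁)) is finite, there exists q̄ ∈ C¹([t₀,t₁],ℝ^d) with q̄(t₀) = q₀, q̄(t₁) = q₁ and I[q̄] = 𝓘((t₀,q₀),(t₁,q₁)), i.e. the classical action attains its infimum. -/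
open Set

/-- The Eisenhart metric in Bargmann form on `M = ℝ × (Fin d → ℝ) × ℝ`:
`g_x(V,V') = a(t,q)(v,v') − τ(υ'−b v') − τ'(υ−b v) − 2𝒰ττ'`. -/
noncomputable def barG {d : ℕ}
    (a : ℝ → (Fin d → ℝ) → (Fin d → ℝ) → (Fin d → ℝ) → ℝ)
    (b : ℝ → (Fin d → ℝ) → (Fin d → ℝ) → ℝ)
    (𝒰 : ℝ → (Fin d → ℝ) → ℝ)
    (x V V' : ℝ × (Fin d → ℝ) × ℝ) : ℝ :=
  a x.1 x.2.1 V.2.1 V'.2.1 - V.1 * (V'.2.2 - b x.1 x.2.1 V'.2.1)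
    - V'.1 * (V.2.2 - b x.1 x.2.1 V.2.1) - 2 * 𝒰 x.1 x.2.1 * V.1 * V'.1

/-- The classical Lagrangian `L(t,q,q̇) = ½ a(t,q)(q̇,q̇) + b(t,q)(q̇) − 𝒰(t,q)`. -/
noncomputable def classicalLag {d : ℕ}
    (a : ℝ → (Fin d → ℝ) → (Fin d → ℝ) → (Fin d → ℝ) → ℝ)
    (b : ℝ → (Fin d → ℝ) → (Fin d → ℝ) → ℝ)
    (𝒰 : ℝ → (Fin d → ℝ) → ℝ)
    (t : ℝ) (p v : Fin d → ℝ) : ℝ :=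
  (1 / 2) * a t p v v + b t p v - 𝒰 t p

/-- A vector `V = (τ,v,υ)` is future-directed causal at `x` if `Q_x(V) ≤ 0` and
either `τ > 0`, or `τ = 0` and `υ > 0`. -/
def FDCausalB {d : ℕ}
    (a : ℝ → (Fin d → ℝ) → (Fin d → ℝ) → (Fin d → ℝ) → ℝ)
    (b : ℝ → (Fin d → ℝ) → (Fin d → ℝ) → ℝ)
    (𝒰 : ℝ → (Fin d → ℝ) → ℝ)
    (x V : ℝ × (Fin d → ℝ) × ℝ) : Prop :=
  barG a b 𝒰 x V V ≤ 0 ∧ (0 < V.1 ∨ (V.1 = 0 ∧ 0 < V.2.2))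

/-- `x : [λ₀,λ₁] → M` is a future-directed causal C¹ curve with derivative `x'`. -/
def CausalCurveB {d : ℕ}
    (a : ℝ → (Fin d → ℝ) → (Fin d → ℝ) → (Fin d → ℝ) → ℝ)
    (b : ℝ → (Fin d → ℝ) → (Fin d → ℝ) → ℝ)
    (𝒰 : ℝ → (Fin d → ℝ) → ℝ)
    (x x' : ℝ → ℝ × (Fin d → ℝ) × ℝ) (lam₀ lam₁ : ℝ) : Prop :=
  (∀ l ∈ Icc lam₀ lam₁, HasDerivWithinAt x (x' l) (Icc lam₀ lam₁) l) ∧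
  ContinuousOn x' (Icc lam₀ lam₁) ∧
  ∀ l ∈ Icc lam₀ lam₁, FDCausalB a b 𝒰 (x l) (x' l)

/-- The causal future `J⁺(m)`: `m` together with all endpoints of future-directed
causal curves starting at `m`. -/
def JplusB {d : ℕ}
    (a : ℝ → (Fin d → ℝ) → (Fin d → ℝ) → (Fin d → ℝ) → ℝ)
    (b : ℝ → (Fin d → ℝ) → (Fin d → ℝ) → ℝ)
    (𝒰 : ℝ → (Fin d → ℝ) → ℝ)
    (m : ℝ × (Fin d → ℝ) × ℝ) : Set (ℝ × (Fin d → ℝ) × ℝ) :=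
  insert m {m' | ∃ (lam₀ lam₁ : ℝ) (x x' : ℝ → ℝ × (Fin d → ℝ) × ℝ),
    lam₀ < lam₁ ∧ CausalCurveB a b 𝒰 x x' lam₀ lam₁ ∧ x lam₀ = m ∧ x lam₁ = m'}

/-- The causal past `J⁻(m) = {m' : m ∈ J⁺(m')}`. -/
def JminusB {d : ℕ}
    (a : ℝ → (Fin d → ℝ) → (Fin d → ℝ) → (Fin d → ℝ) → ℝ)
    (b : ℝ → (Fin d → ℝ) → (Fin d → ℝ) → ℝ)
    (𝒰 : ℝ → (Fin d → ℝ) → ℝ)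
    (m : ℝ × (Fin d → ℝ) × ℝ) : Set (ℝ × (Fin d → ℝ) × ℝ) :=
  {m' | m ∈ JplusB a b 𝒰 m'}

/-- Values of the classical action on C¹ curves from `(t₀,q₀)` to `(t₁,q₁)`. -/
noncomputable def actionSet {d : ℕ}
    (a : ℝ → (Fin d → ℝ) → (Fin d → ℝ) → (Fin d → ℝ) → ℝ)
    (b : ℝ → (Fin d → ℝ) → (Fin d → ℝ) → ℝ)
    (𝒰 : ℝ → (Fin d → ℝ) → ℝ)
    (t₀ t₁ : ℝ) (q₀ q₁ : Fin d → ℝ) : Set ℝ :=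
  {I : ℝ | ∃ q q' : ℝ → Fin d → ℝ,
    (∀ t ∈ Icc t₀ t₁, HasDerivWithinAt q (q' t) (Icc t₀ t₁) t) ∧
    ContinuousOn q' (Icc t₀ t₁) ∧ q t₀ = q₀ ∧ q t₁ = q₁ ∧
    I = ∫ s in t₀..t₁, classicalLag a b 𝒰 s (q s) (q' s)}

open Classical in
/-- The extended-real-valued function `𝓘`: the infimum of the classical action for
`t₀ < t₁`; `+∞` for `t₀ > t₁` or `t₀ = t₁, q₀ ≠ q₁`; `0` for coincident events. -/
noncomputable def IfunB {d : ℕ}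
    (a : ℝ → (Fin d → ℝ) → (Fin d → ℝ) → (Fin d → ℝ) → ℝ)
    (b : ℝ → (Fin d → ℝ) → (Fin d → ℝ) → ℝ)
    (𝒰 : ℝ → (Fin d → ℝ) → ℝ)
    (e₀ e₁ : ℝ × (Fin d → ℝ)) : EReal :=
  if e₀.1 < e₁.1 then
    sInf ((fun r : ℝ => (r : EReal)) '' actionSet a b 𝒰 e₀.1 e₁.1 e₀.2 e₁.2)
  else if e₀.1 = e₁.1 ∧ e₀.2 = e₁.2 then 0 else ⊤

open Filter Topology MeasureTheory intervalIntegral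

/-- A C¹ curve on a compact interval extends to a C¹ curve on the line, with velocity constant
outside the interval. -/
theorem exists_global_C1_extension {F : Type*} [NormedAddCommGroup F] [NormedSpace ℝ F]
    [CompleteSpace F] {x x' : ℝ → F} {α β : ℝ} (h : α ≤ β)
    (hx : ∀ l ∈ Icc α β, HasDerivWithinAt x (x' l) (Icc α β) l)
    (hc : ContinuousOn x' (Icc α β)) :
    ∃ X X' : ℝ → F, Continuous X' ∧ (∀ l, HasDerivAt X (X' l) l) ∧
      (∀ l ∈ Icc α β, X l = x l) ∧ ∀ l, X' l = x' (projIcc α β h l) := by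
  have hX' : Continuous (fun l => x' (projIcc α β h l)) :=
    hc.comp_continuous (by fun_prop) fun l => (projIcc α β h l).2
  refine ⟨fun l => x α + ∫ s in α..l, x' (projIcc α β h s), fun l => x' (projIcc α β h l), hX',
    fun l => ?_, fun l hl => ?_, fun l => rfl⟩
  · exact (hX'.integral_hasStrictDerivAt α l).hasDerivAt.const_add _
  · have : ∫ s in α..l, x' (projIcc α β h s) = x l - x α := by
      apply integral_eq_sub_of_hasDerivAt_of_le hl.1
      · exact (fun s hs => ((hx s ⟨hs.1, hs.2.trans hl.2⟩).continuousWithinAt.mono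
          (Icc_subset_Icc_right hl.2)))
      · intro s hs
        have hs' : s ∈ Ioo α β := ⟨hs.1, hs.2.trans_le hl.2⟩
        rw [projIcc_of_mem h (Ioo_subset_Icc_self hs')]
        exact (hx s (Ioo_subset_Icc_self hs')).hasDerivAt (Icc_mem_nhds hs'.1 hs'.2)
      · exact hX'.intervalIntegrable _ _
    simp [this]

theorem exists_primitive {f : ℝ → ℝ} {α β : ℝ} (h : α ≤ β) (hc : ContinuousOn f (Icc α β)) :
    ∃ F : ℝ → ℝ, (∀ l ∈ Icc α β, HasDerivWithinAt F (f l) (Icc α β) l) ∧ F α = 0 ∧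
      F β = ∫ s in α..β, f s := by
  have hX' : Continuous (fun l => f (projIcc α β h l)) :=
    hc.comp_continuous (by fun_prop) fun l => (projIcc α β h l).2
  refine ⟨fun l => ∫ s in α..l, f (projIcc α β h s), fun l hl => ?_, by simp, ?_⟩
  · have := (hX'.integral_hasStrictDerivAt α l).hasDerivAt.hasDerivWithinAt (s := Icc α β)
    rwa [projIcc_of_mem h hl] at this
  · apply integral_congr
    intro s hs
    rw [uIcc_of_le h] at hs
    simp only [projIcc_of_mem h hs]

/-- Inverse of a C¹ reparametrization with positive speed on a compact interval. -/
theorem exists_inverse_reparam {t T : ℝ → ℝ} {α β : ℝ} (h : α < β)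
    (ht : ∀ l ∈ Icc α β, HasDerivWithinAt t (T l) (Icc α β) l)
    (hT : ContinuousOn T (Icc α β)) (hpos : ∀ l ∈ Icc α β, 0 < T l) :
    t α < t β ∧ ∃ g : ℝ → ℝ, (∀ l ∈ Icc α β, g (t l) = l) ∧
      MapsTo t (Icc α β) (Icc (t α) (t β)) ∧
      MapsTo g (Icc (t α) (t β)) (Icc α β) ∧
      ∀ s ∈ Icc (t α) (t β), HasDerivWithinAt g (T (g s))⁻¹ (Icc (t α) (t β)) s := by
  obtain ⟨X, X', hX'c, hX, hXx, hX'⟩ := exists_global_C1_extension h.le ht hT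
  obtain ⟨m, hm, hmin⟩ := isCompact_Icc.exists_isMinOn (nonempty_Icc.2 h.le) hT
  have hτ : 0 < T m := hpos m hm
  have hlow : ∀ l, T m ≤ X' l := fun l => by
    rw [hX']; exact hmin (projIcc α β h.le l).2
  have hd : Differentiable ℝ X := fun l => (hX l).differentiableAt
  have hmono : StrictMono X := strictMono_of_deriv_pos fun l => by
    rw [(hX l).deriv]; exact hτ.trans_le (hlow l)
  have hgrow : ∀ ⦃x y⦄, x ≤ y → T m * (y - x) ≤ X y - X x :=
    mul_sub_le_image_sub_of_le_deriv hd fun l => by rw [(hX l).deriv]; exact hlow l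
  have hsurj : Function.Surjective X := by
    apply hd.continuous.surjective
    · refine tendsto_atTop_mono' _ (f₁ := fun l => T m * l + X 0) ?_ ?_
      · filter_upwards [eventually_ge_atTop 0] with l hl
        have := hgrow hl
        linarith
      · exact tendsto_atTop_add_const_right _ _ (tendsto_id.const_mul_atTop hτ)
    · refine tendsto_atBot_mono' _ (f₁ := fun l => T m * l + X 0) ?_ ?_
      · filter_upwards [eventually_le_atBot 0] with l hl
        have := hgrow hl
        linarith
      · exact tendsto_atBot_add_const_right _ _ (tendsto_id.const_mul_atBot hτ)
  let e := hmono.orderIsoOfSurjective X hsurj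
  have he : ∀ l, e l = X l := fun l => rfl
  have hes : ∀ s, X (e.symm s) = s := fun s => e.apply_symm_apply s
  have hα := hXx α (left_mem_Icc.2 h.le)
  have hβ := hXx β (right_mem_Icc.2 h.le)
  have hmaps : MapsTo e.symm (Icc (t α) (t β)) (Icc α β) := by
    intro s hs
    rw [← hα, ← hβ] at hs
    constructor
    · rw [e.le_symm_apply]; exact hs.1
    · rw [e.symm_apply_le]; exact hs.2
  refine ⟨by rw [← hα, ← hβ]; exact hmono h, e.symm, fun l hl => ?_, fun l hl => ?_, hmaps,
    fun s hs => ?_⟩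
  · rw [← hXx l hl, ← he, e.symm_apply_apply]
  · rw [← hα, ← hβ, ← hXx l hl]
    exact ⟨hmono.monotone hl.1, hmono.monotone hl.2⟩
  · have := (hX (e.symm s)).of_local_left_inverse (g := e.symm) (a := s)
      e.symm.continuous.continuousAt (hτ.trans_le (hlow _)).ne' (Eventually.of_forall hes)
    rw [hX', projIcc_of_mem h.le (hmaps hs)] at this
    exact this.hasDerivWithinAt

/-- Gluing of C¹ curves whose values and velocities agree at the junction. -/
theorem hasDerivWithinAt_glue {F : Type*} [NormedAddCommGroup F] [NormedSpace ℝ F]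
    {x x' z z' : ℝ → F} {α β γ : ℝ} (hαβ : α ≤ β) (hβγ : β ≤ γ)
    (hx : ∀ l ∈ Icc α β, HasDerivWithinAt x (x' l) (Icc α β) l)
    (hz : ∀ l ∈ Icc β γ, HasDerivWithinAt z (z' l) (Icc β γ) l)
    (hxz : x β = z β) (hxz' : x' β = z' β) :
    ∀ l ∈ Icc α γ, HasDerivWithinAt (fun l => if l ≤ β then x l else z l)
      (if l ≤ β then x' l else z' l) (Icc α γ) l := by
  intro l hl
  have hleft : l ≤ β → HasDerivWithinAt (fun l => if l ≤ β then x l else z l) (x' l)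
      (Icc α β) l := fun h =>
    (hx l ⟨hl.1, h⟩).congr (fun s hs => if_pos hs.2) (if_pos h)
  have hright : β ≤ l → HasDerivWithinAt (fun l => if l ≤ β then x l else z l) (z' l)
      (Icc β γ) l := by
    have key : ∀ s, β ≤ s → (if s ≤ β then x s else z s) = z s := by
      intro s hs
      split_ifs with h
      · rw [le_antisymm h hs, hxz]
      · rfl
    exact fun h => (hz l ⟨h, hl.2⟩).congr (fun s hs => key s hs.1) (key l h)
  rcases lt_trichotomy l β with h | h | h
  · rw [if_pos h.le]
    refine (hleft h.le).mono_of_mem_nhdsWithin ?_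
    filter_upwards [self_mem_nhdsWithin, mem_nhdsWithin_of_mem_nhds (Iio_mem_nhds h)] with s hs hs'
    exact ⟨hs.1, le_of_lt hs'⟩
  · subst h
    rw [if_pos le_rfl, ← Icc_union_Icc_eq_Icc hαβ hβγ]
    refine (hleft le_rfl).union ?_
    have := hright le_rfl
    rwa [← hxz'] at this
  · rw [if_neg h.not_ge]
    refine (hright h.le).mono_of_mem_nhdsWithin ?_
    filter_upwards [self_mem_nhdsWithin, mem_nhdsWithin_of_mem_nhds (Ioi_mem_nhds h)] with s hs hs'
    exact ⟨le_of_lt hs', hs.2⟩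

theorem continuousOn_glue {F : Type*} [TopologicalSpace F] {x z : ℝ → F} {α β γ : ℝ}
    (hx : ContinuousOn x (Icc α β)) (hz : ContinuousOn z (Icc β γ)) (hxz : x β = z β) :
    ContinuousOn (fun l => if l ≤ β then x l else z l) (Icc α γ) := by
  refine ContinuousOn.if (fun l hl => ?_) (hx.mono ?_) (hz.mono ?_)
  · have : l = β := by simpa using frontier_le_subset_eq continuous_id continuous_const hl.2
    rw [this, hxz]
  · rintro l ⟨hl, hl'⟩
    have : closure {l : ℝ | l ≤ β} = Iic β := isClosed_Iic.closure_eq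
    rw [this] at hl'
    exact ⟨hl.1, hl'⟩
  · rintro l ⟨hl, hl'⟩
    have : closure {l : ℝ | ¬ l ≤ β} ⊆ Ici β :=
      closure_minimal (fun s hs => (not_le.1 hs).le) isClosed_Ici
    exact ⟨this hl', hl.2⟩

/-- The consequences of the algebraic and regularity assumptions on `(a, b, 𝒰)` used below. -/
structure RegularLagrangian {d : ℕ}
    (a : ℝ → (Fin d → ℝ) → (Fin d → ℝ) → (Fin d → ℝ) → ℝ)
    (b : ℝ → (Fin d → ℝ) → (Fin d → ℝ) → ℝ)
    (𝒰 : ℝ → (Fin d → ℝ) → ℝ) : Prop where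
  a_smul : ∀ t q (c : ℝ) v, a t q (c • v) (c • v) = c ^ 2 * a t q v v
  a_pos : ∀ t q v, v ≠ 0 → 0 < a t q v v
  b_smul : ∀ t q (c : ℝ) v, b t q (c • v) = c * b t q v
  a_contDiff : ContDiff ℝ 1 (fun z : ℝ × (Fin d → ℝ) × (Fin d → ℝ) => a z.1 z.2.1 z.2.2 z.2.2)
  b_contDiff : ContDiff ℝ 1 (fun z : ℝ × (Fin d → ℝ) × (Fin d → ℝ) => b z.1 z.2.1 z.2.2)
  U_contDiff : ContDiff ℝ 1 (fun p : ℝ × (Fin d → ℝ) => 𝒰 p.1 p.2)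

theorem contDiff_of_linear {d : ℕ} {f : ℝ → (Fin d → ℝ) → (Fin d → ℝ) → ℝ}
    (hlin : ∀ t q, IsLinearMap ℝ (f t q))
    (hreg : ∀ v, ContDiff ℝ 1 (fun p : ℝ × (Fin d → ℝ) => f p.1 p.2 v)) :
    ContDiff ℝ 1 (fun z : ℝ × (Fin d → ℝ) × (Fin d → ℝ) => f z.1 z.2.1 z.2.2) := by
  have hsum : (fun z : ℝ × (Fin d → ℝ) × (Fin d → ℝ) => f z.1 z.2.1 z.2.2) =
      fun z => ∑ i, z.2.2 i * f z.1 z.2.1 (Pi.single i 1) := by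
    funext z
    have := (hlin z.1 z.2.1).mk'.pi_apply_eq_sum_univ z.2.2
    simp only [IsLinearMap.mk'_apply, smul_eq_mul] at this
    rw [this]
    refine Finset.sum_congr rfl fun i _ => ?_
    congr 2
    funext j
    simp [Pi.single_apply, eq_comm]
  rw [hsum]
  refine ContDiff.sum fun i _ => ContDiff.mul (by fun_prop) ?_
  exact (hreg (Pi.single i 1)).comp
    (f := fun z : ℝ × (Fin d → ℝ) × (Fin d → ℝ) => (z.1, z.2.1)) (by fun_prop)

theorem RegularLagrangian.of_bilinear {d : ℕ}
    {a : ℝ → (Fin d → ℝ) → (Fin d → ℝ) → (Fin d → ℝ) → ℝ}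
    {b : ℝ → (Fin d → ℝ) → (Fin d → ℝ) → ℝ} {𝒰 : ℝ → (Fin d → ℝ) → ℝ}
    (hsymm : ∀ t q v w, a t q v w = a t q w v)
    (halin : ∀ t q w, IsLinearMap ℝ (fun v => a t q v w))
    (hapos : ∀ t q v, v ≠ 0 → 0 < a t q v v)
    (hblin : ∀ t q, IsLinearMap ℝ (b t q))
    (hareg : ∀ v w, ContDiff ℝ 1 (fun p : ℝ × (Fin d → ℝ) => a p.1 p.2 v w))
    (hbreg : ∀ v, ContDiff ℝ 1 (fun p : ℝ × (Fin d → ℝ) => b p.1 p.2 v))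
    (hUreg : ContDiff ℝ 1 (fun p : ℝ × (Fin d → ℝ) => 𝒰 p.1 p.2)) :
    RegularLagrangian a b 𝒰 where
  a_smul t q c v := by
    have h1 := (halin t q (c • v)).map_smul c v
    have h2 := (halin t q v).map_smul c v
    simp only [smul_eq_mul] at h1 h2
    rw [h1, hsymm, h2]
    ring
  a_pos := hapos
  b_smul t q c v := (hblin t q).map_smul c v
  a_contDiff := by
    have hsum : (fun z : ℝ × (Fin d → ℝ) × (Fin d → ℝ) => a z.1 z.2.1 z.2.2 z.2.2) =
        fun z => ∑ i, z.2.2 i * a z.1 z.2.1 (Pi.single i 1) z.2.2 := by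
      funext z
      have := (halin z.1 z.2.1 z.2.2).mk'.pi_apply_eq_sum_univ z.2.2
      simp only [IsLinearMap.mk'_apply, smul_eq_mul] at this
      rw [this]
      refine Finset.sum_congr rfl fun i _ => ?_
      congr 2
      funext j
      simp [Pi.single_apply, eq_comm]
    rw [hsum]
    refine ContDiff.sum fun i _ => ContDiff.mul (by fun_prop) ?_
    refine contDiff_of_linear (f := fun t q v => a t q (Pi.single i 1) v) (fun t q => ?_)
      (fun v => hareg _ v)
    simp only [hsymm t q (Pi.single i 1)]
    exact halin t q _
  b_contDiff := contDiff_of_linear hblin hbreg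
  U_contDiff := hUreg

namespace RegularLagrangian

variable {d : ℕ} {a : ℝ → (Fin d → ℝ) → (Fin d → ℝ) → (Fin d → ℝ) → ℝ}
  {b : ℝ → (Fin d → ℝ) → (Fin d → ℝ) → ℝ} {𝒰 : ℝ → (Fin d → ℝ) → ℝ}

theorem a_zero (H : RegularLagrangian a b 𝒰) (t : ℝ) (q : Fin d → ℝ) : a t q 0 0 = 0 := by
  simpa using H.a_smul t q 0 0

theorem b_zero (H : RegularLagrangian a b 𝒰) (t : ℝ) (q : Fin d → ℝ) : b t q 0 = 0 := by
  simpa using H.b_smul t q 0 0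

theorem a_nonneg (H : RegularLagrangian a b 𝒰) (t : ℝ) (q v : Fin d → ℝ) : 0 ≤ a t q v v := by
  by_cases h : v = 0
  · rw [h, H.a_zero]
  · exact (H.a_pos t q v h).le

theorem continuous_a (H : RegularLagrangian a b 𝒰) :
    Continuous (fun z : ℝ × (Fin d → ℝ) × (Fin d → ℝ) => a z.1 z.2.1 z.2.2 z.2.2) :=
  H.a_contDiff.continuous

theorem continuous_b (H : RegularLagrangian a b 𝒰) :
    Continuous (fun z : ℝ × (Fin d → ℝ) × (Fin d → ℝ) => b z.1 z.2.1 z.2.2) :=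
  H.b_contDiff.continuous

theorem continuous_U (H : RegularLagrangian a b 𝒰) :
    Continuous (fun p : ℝ × (Fin d → ℝ) => 𝒰 p.1 p.2) :=
  H.U_contDiff.continuous

theorem continuous_lag (H : RegularLagrangian a b 𝒰) :
    Continuous (fun z : ℝ × (Fin d → ℝ) × (Fin d → ℝ) =>
      classicalLag a b 𝒰 z.1 z.2.1 z.2.2) :=
  ((continuous_const.mul H.continuous_a).add H.continuous_b).sub
    (H.continuous_U.comp (by fun_prop : Continuous
      fun z : ℝ × (Fin d → ℝ) × (Fin d → ℝ) => (z.1, z.2.1)))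

theorem continuousOn_lag (H : RegularLagrangian a b 𝒰) {q q' : ℝ → Fin d → ℝ} {s : Set ℝ}
    (hq : ContinuousOn q s) (hq' : ContinuousOn q' s) :
    ContinuousOn (fun t => classicalLag a b 𝒰 t (q t) (q' t)) s :=
  H.continuous_lag.comp_continuousOn (continuousOn_id.prodMk (hq.prodMk hq'))

/-- The homogeneous (parametrization invariant) action of a C¹ curve `(t, q)` with `t' > 0` is the
classical action of a C¹ curve. -/
theorem homogeneous_action_mem (H : RegularLagrangian a b 𝒰) {t T : ℝ → ℝ}
    {q Q : ℝ → Fin d → ℝ} {α β : ℝ} (h : α < β)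
    (ht : ∀ l ∈ Icc α β, HasDerivWithinAt t (T l) (Icc α β) l)
    (hT : ContinuousOn T (Icc α β)) (hpos : ∀ l ∈ Icc α β, 0 < T l)
    (hq : ∀ l ∈ Icc α β, HasDerivWithinAt q (Q l) (Icc α β) l)
    (hQ : ContinuousOn Q (Icc α β)) :
    (∫ l in α..β, ((1 / 2) * a (t l) (q l) (Q l) (Q l) / T l + b (t l) (q l) (Q l)
      - 𝒰 (t l) (q l) * T l)) ∈ actionSet a b 𝒰 (t α) (t β) (q α) (q β) := by
  obtain ⟨htt, g, hgt, htm, hgm, hg⟩ := exists_inverse_reparam h ht hT hpos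
  have hgc : ContinuousOn g (Icc (t α) (t β)) := fun s hs => (hg s hs).continuousWithinAt
  have htc : ContinuousOn t (Icc α β) := fun s hs => (ht s hs).continuousWithinAt
  have hqc : ContinuousOn q (Icc α β) := fun s hs => (hq s hs).continuousWithinAt
  have hder : ∀ s ∈ Icc (t α) (t β), HasDerivWithinAt (q ∘ g) ((T (g s))⁻¹ • Q (g s))
      (Icc (t α) (t β)) s := fun s hs => (hq (g s) (hgm hs)).scomp s (hg s hs) hgm
  have hcont : ContinuousOn (fun s => (T (g s))⁻¹ • Q (g s)) (Icc (t α) (t β)) :=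
    ((hT.comp hgc hgm).inv₀ fun s hs => (hpos _ (hgm hs)).ne').smul (hQ.comp hgc hgm)
  have hα : g (t α) = α := hgt α (left_mem_Icc.2 h.le)
  have hβ : g (t β) = β := hgt β (right_mem_Icc.2 h.le)
  refine ⟨q ∘ g, fun s => (T (g s))⁻¹ • Q (g s), hder, hcont, by simp [hα], by simp [hβ], ?_⟩
  rw [← integral_comp_mul_deriv'' (f := t) (f' := T) (a := α) (b := β)
    (g := fun s => classicalLag a b 𝒰 s ((q ∘ g) s) ((T (g s))⁻¹ • Q (g s)))]
  · apply integral_congr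
    intro l hl
    rw [uIcc_of_le h.le] at hl
    have := (hpos l hl).ne'
    simp only [Function.comp, hgt l hl, classicalLag, H.a_smul, H.b_smul]
    field_simp
  · rwa [uIcc_of_le h.le]
  · intro l hl
    rw [min_eq_left h.le, max_eq_right h.le] at hl
    exact ((ht l (Ioo_subset_Icc_self hl)).hasDerivAt (Icc_mem_nhds hl.1 hl.2)).hasDerivWithinAt
  · rwa [uIcc_of_le h.le]
  · rw [uIcc_of_le h.le]
    exact (H.continuousOn_lag (hqc.comp hgc hgm) hcont).mono htm.image_subset

end RegularLagrangian

/-- Lipschitz control in time of the coefficients of the Lagrangian on bounded sets, relative to the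
kinetic term for the quadratic part. -/
theorem RegularLagrangian.exists_time_bound {d : ℕ}
    {a : ℝ → (Fin d → ℝ) → (Fin d → ℝ) → (Fin d → ℝ) → ℝ}
    {b : ℝ → (Fin d → ℝ) → (Fin d → ℝ) → ℝ} {𝒰 : ℝ → (Fin d → ℝ) → ℝ}
    (H : RegularLagrangian a b 𝒰) {R : ℝ} (hR : 1 ≤ R) :
    ∃ C : ℝ, 0 ≤ C ∧ ∀ t t' q, |t| ≤ R → |t'| ≤ R → ‖q‖ ≤ R →
      (∀ v, a t' q v v ≤ (1 + C * |t' - t|) * a t q v v) ∧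
      (∀ v, b t' q v ≤ b t q v + C * |t' - t| * ‖v‖) ∧
      |𝒰 t' q - 𝒰 t q| ≤ C * |t' - t| ∧ |𝒰 t q| ≤ C := by
  have hK : IsCompact (Metric.closedBall (0 : ℝ × (Fin d → ℝ) × (Fin d → ℝ)) R) :=
    isCompact_closedBall _ _
  have hK2 : IsCompact (Metric.closedBall (0 : ℝ × (Fin d → ℝ)) R) := isCompact_closedBall _ _
  obtain ⟨Ka, hKa⟩ :=
    H.a_contDiff.locallyLipschitz.locallyLipschitzOn.exists_lipschitzOnWith_of_compact hK
  obtain ⟨Kb, hKb⟩ :=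
    H.b_contDiff.locallyLipschitz.locallyLipschitzOn.exists_lipschitzOnWith_of_compact hK
  obtain ⟨KU, hKU⟩ :=
    H.U_contDiff.locallyLipschitz.locallyLipschitzOn.exists_lipschitzOnWith_of_compact hK2
  obtain ⟨BU, hBU⟩ := hK2.exists_bound_of_continuousOn H.continuous_U.continuousOn
  obtain ⟨m, hm, hmle⟩ : ∃ m : ℝ, 0 < m ∧ ∀ z ∈ Metric.closedBall
      (0 : ℝ × (Fin d → ℝ) × (Fin d → ℝ)) R ∩ {z | ‖z.2.2‖ = 1}, m ≤ a z.1 z.2.1 z.2.2 z.2.2 := by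
    refine IsCompact.exists_forall_le' (hK.inter_right ?_) H.continuous_a.continuousOn ?_
    · exact isClosed_eq (by fun_prop) continuous_const
    · rintro z ⟨-, hz⟩
      refine H.a_pos _ _ _ fun h => ?_
      simp [h] at hz
  have mem3 : ∀ {t q} {v : Fin d → ℝ}, |t| ≤ R → ‖q‖ ≤ R → ‖v‖ = 1 →
      (t, q, v) ∈ Metric.closedBall (0 : ℝ × (Fin d → ℝ) × (Fin d → ℝ)) R := by
    intro t q v ht hq hv
    simp only [mem_closedBall_zero_iff, Prod.norm_def, sup_le_iff]
    exact ⟨ht, hq, by rw [hv]; exact hR⟩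
  have mem2 : ∀ {t} {q : Fin d → ℝ}, |t| ≤ R → ‖q‖ ≤ R →
      (t, q) ∈ Metric.closedBall (0 : ℝ × (Fin d → ℝ)) R := by
    intro t q ht hq
    simp only [mem_closedBall_zero_iff, Prod.norm_def, sup_le_iff]
    exact ⟨ht, hq⟩
  have hmax : ∀ r : ℝ, max |r| 0 = |r| := fun r => max_eq_left (abs_nonneg r)
  have polar : ∀ v : Fin d → ℝ, v ≠ 0 → ∃ (r : ℝ) (u : Fin d → ℝ), 0 ≤ r ∧ ‖u‖ = 1 ∧ v = r • u := by
    intro v hv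
    have hn : ‖v‖ ≠ 0 := norm_ne_zero_iff.2 hv
    exact ⟨‖v‖, ‖v‖⁻¹ • v, norm_nonneg v,
      by rw [norm_smul, norm_inv, norm_norm, inv_mul_cancel₀ hn], (smul_inv_smul₀ hn v).symm⟩
  have hBU0 : 0 ≤ BU := (norm_nonneg _).trans (hBU 0 (by simpa using zero_le_one.trans hR))
  have hKm : 0 ≤ (Ka : ℝ) / m := by positivity
  refine ⟨Ka / m + Kb + KU + BU, by positivity, fun t t' q ht ht' hq => ⟨fun v => ?_, fun v => ?_,
    ?_, ?_⟩⟩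
  · rcases eq_or_ne v 0 with rfl | hv
    · simp [H.a_zero]
    obtain ⟨r, u, hr, hun, rfl⟩ := polar v hv
    rw [H.a_smul, H.a_smul]
    have h1 := hKa.dist_le_mul (t', q, u) (mem3 ht' hq hun) (t, q, u) (mem3 ht hq hun)
    have h2 := hmle (t, q, u) ⟨mem3 ht hq hun, hun⟩
    simp only [Prod.dist_eq, dist_self, Real.dist_eq, hmax] at h1 h2
    have h3 : (Ka : ℝ) * |t' - t| ≤ (Ka / m) * |t' - t| * a t q u u := by
      calc (Ka : ℝ) * |t' - t| = (Ka / m) * |t' - t| * m := by field_simp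
        _ ≤ _ := by gcongr
    have h4 : 0 ≤ (Kb + KU + BU) * |t' - t| * a t q u u := by
      have := H.a_nonneg t q u
      positivity
    have h5 : a t' q u u ≤ (1 + (Ka / m + Kb + KU + BU) * |t' - t|) * a t q u u := by
      have := (abs_le.1 h1).2
      nlinarith
    calc _ ≤ r ^ 2 * ((1 + (Ka / m + Kb + KU + BU) * |t' - t|) * a t q u u) := by gcongr
      _ = _ := by ring
  · rcases eq_or_ne v 0 with rfl | hv
    · simp [H.b_zero]
    obtain ⟨r, u, hr, hun, rfl⟩ := polar v hv
    have h1 := hKb.dist_le_mul (t', q, u) (mem3 ht' hq hun) (t, q, u) (mem3 ht hq hun)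
    simp only [Prod.dist_eq, dist_self, Real.dist_eq, hmax] at h1
    have h4 : 0 ≤ (Ka / m + KU + BU) * |t' - t| := by positivity
    have h5 : b t' q u ≤ b t q u + (Ka / m + Kb + KU + BU) * |t' - t| := by
      have := (abs_le.1 h1).2
      nlinarith
    rw [H.b_smul, H.b_smul, norm_smul, hun, Real.norm_of_nonneg hr]
    nlinarith
  · have h1 := hKU.dist_le_mul (t', q) (mem2 ht' hq) (t, q) (mem2 ht hq)
    simp only [Prod.dist_eq, dist_self, Real.dist_eq, hmax] at h1
    refine h1.trans ?_
    gcongr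
    have := Kb.coe_nonneg
    linarith
  · have h1 := hBU (t, q) (mem2 ht hq)
    rw [Real.norm_eq_abs] at h1
    have := Kb.coe_nonneg
    have := KU.coe_nonneg
    linarith

/-- Cost of changing the time velocity `T` of a causal vector to
`T + (δ - T)⁺ - sκ (T - τ)⁺`: the energy `E` is bounded below where time is accelerated, and this
beats all errors when `δ` is small. -/
theorem time_change_cost_le {A A' β β' U U' T E Y B C c δ τ κ s : ℝ}
    (hAE : A ≤ T * E) (hA' : A' ≤ (1 + C * s) * A) (hβ : β' ≤ β + C * s * B)
    (hU : |U| ≤ C) (hU' : |U' - U| ≤ C * s) (hT0 : 0 ≤ T) (hTB : T ≤ B) (hE0 : 0 ≤ E)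
    (hEB : E ≤ B) (hE : E = Y - β + U * T) (hc : T < δ → c ≤ E) (hδ : 0 < δ)
    (hδτ : δ < τ) (hδ1 : δ ≤ 1) (hs : 0 ≤ s) (hκ : 0 ≤ κ) (hsκ : s * κ ≤ 1 / 2) :
    0 < T + max 0 (δ - T) - s * κ * max 0 (T - τ) ∧
    A' / (T + max 0 (δ - T) - s * κ * max 0 (T - τ)) + β'
        - U' * (T + max 0 (δ - T) - s * κ * max 0 (T - τ)) ≤
      Y - (c / δ - C) * max 0 (δ - T)
        + s * (2 * κ * B + 2 * C * B + C * B + C * κ * B + C * (B + 1)) := by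
  have hC0 : 0 ≤ C := (abs_nonneg _).trans hU
  have hB0 : 0 ≤ B := hT0.trans hTB
  have hsk0 : 0 ≤ s * κ := mul_nonneg hs hκ
  set p := max 0 (δ - T) with hp
  set m := max 0 (T - τ) with hm
  have hp0 : 0 ≤ p := le_max_left _ _
  have hm0 : 0 ≤ m := le_max_left _ _
  have hmT : m ≤ T := max_le hT0 (by linarith)
  have hpδ : p ≤ δ := max_le hδ.le (by linarith)
  obtain ⟨T', hT'⟩ : ∃ T', T' = T + p - s * κ * m := ⟨_, rfl⟩
  rw [← hT']
  have hsm : s * κ * m ≤ s * κ * T := by gcongr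
  have hT'low : T / 2 ≤ T' := by nlinarith
  have hT'pos : 0 < T' := by
    rcases lt_or_ge T δ with h | h
    · have h1 : m = 0 := max_eq_left (by linarith)
      have h2 : p = δ - T := max_eq_right (by linarith)
      rw [hT', h1, h2]; linarith
    · linarith
  have hT'B : T' ≤ B + 1 := by
    have : 0 ≤ s * κ * m := by positivity
    linarith
  have hr2 : T / T' ≤ 2 := by rw [div_le_iff₀ hT'pos]; linarith
  have hr0 : 0 ≤ T / T' := by positivity
  have hEr : T / T' * E ≤ E - c / δ * p + s * (2 * κ * B) := by
    rcases lt_or_ge T δ with h | h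
    · have h1 : m = 0 := max_eq_left (by linarith)
      have h2 : p = δ - T := max_eq_right (by linarith)
      have h3 : T' = δ := by rw [hT', h1, h2]; ring
      have h4 : T / T' * E = E - E / δ * p := by rw [h3, h2]; field_simp; ring
      have h5 : c / δ * p ≤ E / δ * p := by
        have := hc h
        gcongr
      have : 0 ≤ s * (2 * κ * B) := by positivity
      linarith
    · have h2 : p = 0 := max_eq_left (by linarith)
      have h3 : T / T' ≤ 1 + 2 * (s * κ) := by
        rw [div_le_iff₀ hT'pos]
        have : T * (1 - s * κ) ≤ T' := by rw [hT', h2]; linarith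
        nlinarith [mul_nonneg hT0 (mul_nonneg hsk0 (by linarith : 0 ≤ 1 - 2 * (s * κ)))]
      calc T / T' * E ≤ (1 + 2 * (s * κ)) * E := by gcongr
        _ = E + 2 * (s * κ) * E := by ring
        _ ≤ E + 2 * (s * κ) * B := by gcongr
        _ = _ := by rw [h2]; ring
  have hkin : A' / T' ≤ E - c / δ * p + s * (2 * κ * B) + s * (2 * C * B) := by
    have hrE : T / T' * E ≤ 2 * B := by gcongr
    calc A' / T' ≤ (1 + C * s) * (T * E) / T' := by
          gcongr
          exact hA'.trans (by gcongr)
      _ = T / T' * E + C * s * (T / T' * E) := by ring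
      _ ≤ (E - c / δ * p + s * (2 * κ * B)) + C * s * (2 * B) := by gcongr
      _ = _ := by ring
  have hpot : -(U' * T') ≤ -(U * T) + C * p + s * (C * κ * B) + s * (C * (B + 1)) := by
    have h1 : -((U' - U) * T') ≤ C * s * (B + 1) := by
      calc -((U' - U) * T') ≤ |(U' - U) * T'| := neg_le_abs _
        _ = |U' - U| * T' := by rw [abs_mul, abs_of_pos hT'pos]
        _ ≤ _ := by gcongr
    have h2 : -(U * p) ≤ C * p := by
      have := (abs_le.1 hU).1
      nlinarith
    have h3 : U * (s * κ * m) ≤ C * (s * κ * B) := by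
      have := (abs_le.1 hU).2
      have hmB : m ≤ B := hmT.trans hTB
      calc U * (s * κ * m) ≤ C * (s * κ * m) := by gcongr
        _ ≤ _ := by gcongr
    have : U' * T' = (U' - U) * T' + U * T + U * p - U * (s * κ * m) := by
      rw [hT']; ring
    nlinarith
  refine ⟨hT'pos, ?_⟩
  nlinarith

theorem integral_mem_Icc_of_nonneg {f : ℝ → ℝ} (hf : Continuous f) (h0 : ∀ l, 0 ≤ f l)
    {α β l : ℝ} (hl : l ∈ Icc α β) :
    (∫ s in α..l, f s) ∈ Icc 0 (∫ s in α..β, f s) := by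
  have h1 := integral_nonneg (μ := volume) hl.1 (f := f) fun s _ => h0 s
  have h2 := integral_nonneg (μ := volume) hl.2 (f := f) fun s _ => h0 s
  have h3 := integral_add_adjacent_intervals (μ := volume)
    (hf.intervalIntegrable α l) (hf.intervalIntegrable l β)
  exact ⟨h1, by linarith⟩

/-- A causal curve, given by its three components, can be replaced by the graph of a C¹ curve whose
action is at most the increment of the last coordinate, even though the time component may have
critical points. -/
theorem RegularLagrangian.exists_action_le {d : ℕ}
    {a : ℝ → (Fin d → ℝ) → (Fin d → ℝ) → (Fin d → ℝ) → ℝ}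
    {b : ℝ → (Fin d → ℝ) → (Fin d → ℝ) → ℝ} {𝒰 : ℝ → (Fin d → ℝ) → ℝ}
    (H : RegularLagrangian a b 𝒰) {t T y Y : ℝ → ℝ} {q Q : ℝ → Fin d → ℝ} {α β : ℝ} (h : α < β)
    (ht : ∀ l, HasDerivAt t (T l) l) (hq : ∀ l, HasDerivAt q (Q l) l)
    (hy : ∀ l, HasDerivAt y (Y l) l) (hT : Continuous T) (hQ : Continuous Q) (hY : Continuous Y)
    (hcausal : ∀ l ∈ Icc α β, FDCausalB a b 𝒰 (t l, q l, y l) (T l, Q l, Y l))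
    (htt : t α < t β) :
    ∃ I ∈ actionSet a b 𝒰 (t α) (t β) (q α) (q β), I ≤ y β - y α := by
  have htc : Continuous t := continuous_iff_continuousAt.2 fun l => (ht l).continuousAt
  have hqc : Continuous q := continuous_iff_continuousAt.2 fun l => (hq l).continuousAt
  set E : ℝ → ℝ := fun l => Y l - b (t l) (q l) (Q l) + 𝒰 (t l) (q l) * T l with hEdef
  have hEc : Continuous E :=
    (hY.sub (H.continuous_b.comp (htc.prodMk (hqc.prodMk hQ)))).add
      ((H.continuous_U.comp (htc.prodMk hqc)).mul hT)
  have hT0 : ∀ l ∈ Icc α β, 0 ≤ T l := fun l hl => by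
    rcases (hcausal l hl).2 with h | h
    · exact h.le
    · exact h.1.ge
  have hAE : ∀ l ∈ Icc α β, (1 / 2) * a (t l) (q l) (Q l) (Q l) ≤ T l * E l := fun l hl => by
    have := (hcausal l hl).1
    simp only [barG] at this
    simp only [hEdef]
    linarith
  have hTE : ∀ l ∈ Icc α β, 0 < T l ∨ 0 < E l := fun l hl => by
    rcases (hcausal l hl).2 with h | ⟨h1, h2⟩
    · exact Or.inl h
    · right
      have h3 := hAE l hl
      simp only at h1 h2
      have h4 : Q l = 0 := by
        by_contra hne
        have := H.a_pos (t l) (q l) (Q l) hne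
        rw [h1] at h3
        linarith
      simp only [hEdef, h4, h1, H.b_zero]
      linarith
  have hE0 : ∀ l ∈ Icc α β, 0 ≤ E l := fun l hl => by
    rcases hTE l hl with h | h
    · have := H.a_nonneg (t l) (q l) (Q l)
      exact nonneg_of_mul_nonneg_right ((by positivity : (0 : ℝ) ≤ _).trans (hAE l hl)) h
    · exact h.le
  obtain ⟨c, hc, hcTE⟩ : ∃ c : ℝ, 0 < c ∧ ∀ l ∈ Icc α β, c ≤ max (T l) (E l) :=
    isCompact_Icc.exists_forall_le' (hT.max hEc).continuousOn
      fun l hl => lt_max_iff.2 (hTE l hl)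
  obtain ⟨w, hw, hTw⟩ : ∃ w ∈ Icc α β, 0 < T w := by
    by_contra! hcon
    have h1 : ∫ l in α..β, T l = t β - t α :=
      integral_eq_sub_of_hasDerivAt (fun l _ => ht l) (hT.intervalIntegrable _ _)
    have h2 : ∫ l in α..β, T l ≤ ∫ _ in α..β, (0 : ℝ) :=
      integral_mono_on h.le (hT.intervalIntegrable _ _)
        (continuous_const.intervalIntegrable _ _) hcon
    rw [intervalIntegral.integral_zero] at h2
    linarith
  set τ := T w / 2 with hτ
  have hτ0 : 0 < τ := half_pos hTw
  have hmc : Continuous fun l => max 0 (T l - τ) := continuous_const.max (hT.sub continuous_const)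
  set P := ∫ l in α..β, max 0 (T l - τ) with hP
  have hP0 : 0 < P := integral_pos h hmc.continuousOn (fun l _ => le_max_left _ _)
    ⟨w, hw, lt_max_iff.2 (Or.inr (by linarith))⟩
  obtain ⟨Bt, hBt⟩ := isCompact_Icc.exists_bound_of_continuousOn (htc.continuousOn (s := Icc α β))
  obtain ⟨Bq, hBq⟩ := isCompact_Icc.exists_bound_of_continuousOn (hqc.continuousOn (s := Icc α β))
  obtain ⟨BT, hBT⟩ := isCompact_Icc.exists_bound_of_continuousOn (hT.continuousOn (s := Icc α β))
  obtain ⟨BQ, hBQ⟩ := isCompact_Icc.exists_bound_of_continuousOn (hQ.continuousOn (s := Icc α β))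
  obtain ⟨BE, hBE⟩ := isCompact_Icc.exists_bound_of_continuousOn (hEc.continuousOn (s := Icc α β))
  have hα : α ∈ Icc α β := left_mem_Icc.2 h.le
  have hBt0 := (norm_nonneg _).trans (hBt α hα)
  have hBq0 := (norm_nonneg _).trans (hBq α hα)
  have hBT0 := (norm_nonneg _).trans (hBT α hα)
  have hBQ0 := (norm_nonneg _).trans (hBQ α hα)
  have hBE0 := (norm_nonneg _).trans (hBE α hα)
  set R := Bt + Bq + 1 with hR
  set B := BT + BQ + BE with hB
  obtain ⟨C, hC0, hC⟩ := H.exists_time_bound (R := R) (by linarith)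
  set κ := P⁻¹ with hκ
  have hκ0 : 0 < κ := inv_pos.2 hP0
  set D := 2 * κ * B + 2 * C * B + C * B + C * κ * B + C * (B + 1) with hD
  obtain ⟨δ, hδ, hδc, hδτ, hδ1, hδs, hδκ, hδD⟩ : ∃ δ : ℝ, 0 < δ ∧ δ < c ∧ δ < τ ∧ δ ≤ 1 ∧
      δ * (β - α) ≤ 1 ∧ δ * (β - α) * κ ≤ 1 / 2 ∧ δ * (C + D * (β - α)) ≤ c := by
    have key : ∀ K ε : ℝ, 0 < ε → ∀ᶠ δ in 𝓝[>] (0 : ℝ), δ * K < ε := fun K ε hε => by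
      have : Tendsto (fun δ : ℝ => δ * K) (𝓝 0) (𝓝 (0 * K)) := tendsto_id.mul_const K
      rw [zero_mul] at this
      exact (this.eventually_lt_const hε).filter_mono nhdsWithin_le_nhds
    obtain ⟨δ, h0, h1, h2, h3, h4, h5, h6⟩ := ((eventually_mem_nhdsWithin
      (s := Ioi (0 : ℝ))).and ((key 1 c hc).and
      ((key 1 τ hτ0).and ((key 1 1 one_pos).and ((key (β - α) 1 one_pos).and
      ((key ((β - α) * κ) (1 / 2) (by norm_num)).and (key (C + D * (β - α)) c hc))))))).exists
    exact ⟨δ, h0, by linarith, by linarith, by linarith, h4.le, by linarith, h6.le⟩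
  have hpc : Continuous fun l => max 0 (δ - T l) := continuous_const.max (continuous_const.sub hT)
  set s := ∫ l in α..β, max 0 (δ - T l) with hs
  have hs0 : 0 ≤ s := integral_nonneg h.le fun l _ => le_max_left _ _
  have hsδ : s ≤ δ * (β - α) := by
    have : s ≤ ∫ _ in α..β, δ := integral_mono_on h.le (hpc.intervalIntegrable _ _)
      (continuous_const.intervalIntegrable _ _)
      fun l hl => max_le hδ.le (by linarith [hT0 l hl])
    rw [intervalIntegral.integral_const, smul_eq_mul] at this
    linarith
  have hs1 : s ≤ 1 := hsδ.trans hδs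
  have hsκ : s * κ ≤ 1 / 2 := (mul_le_mul_of_nonneg_right hsδ hκ0.le).trans hδκ
  have hsm : ∫ l in α..β, s * κ * max 0 (T l - τ) = s := by
    rw [intervalIntegral.integral_const_mul, ← hP, hκ, mul_assoc, inv_mul_cancel₀ hP0.ne', mul_one]
  have hmc' : Continuous fun l => s * κ * max 0 (T l - τ) := continuous_const.mul hmc
  set T₁ : ℝ → ℝ := fun l => T l + max 0 (δ - T l) - s * κ * max 0 (T l - τ) with hT₁
  have hT₁c : Continuous T₁ := (hT.add hpc).sub hmc'
  set t₁ : ℝ → ℝ := fun l => t l + ((∫ x in α..l, max 0 (δ - T x)) -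
    ∫ x in α..l, s * κ * max 0 (T x - τ)) with ht₁
  have ht₁d : ∀ l, HasDerivAt t₁ (T₁ l) l := fun l => by
    have := (ht l).add (((hpc.integral_hasStrictDerivAt α l).hasDerivAt).sub
      ((hmc'.integral_hasStrictDerivAt α l).hasDerivAt))
    exact this.congr_deriv (by simp only [hT₁]; ring)
  have ht₁c : Continuous t₁ := continuous_iff_continuousAt.2 fun l => (ht₁d l).continuousAt
  have ht₁α : t₁ α = t α := by simp [ht₁]
  have ht₁β : t₁ β = t β := by simp only [ht₁]; rw [hsm, ← hs]; ring
  have hclose : ∀ l ∈ Icc α β, |t₁ l - t l| ≤ s := fun l hl => by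
    have h1 := integral_mem_Icc_of_nonneg hpc (fun l => le_max_left _ _) hl
    have h2 := integral_mem_Icc_of_nonneg hmc'
      (fun l => mul_nonneg (by positivity) (le_max_left _ _)) hl
    rw [hsm] at h2
    rw [← hs] at h1
    simp only [ht₁, add_sub_cancel_left]
    exact abs_sub_le_iff.2 ⟨by linarith [h1.1, h1.2, h2.1, h2.2],
      by linarith [h1.1, h1.2, h2.1, h2.2]⟩
  have hcost : ∀ l ∈ Icc α β, 0 < T₁ l ∧
      (1 / 2) * a (t₁ l) (q l) (Q l) (Q l) / T₁ l + b (t₁ l) (q l) (Q l)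
        - 𝒰 (t₁ l) (q l) * T₁ l ≤ Y l - (c / δ - C) * max 0 (δ - T l) + s * D := fun l hl => by
    have htR : |t l| ≤ R := (hBt l hl).trans (by linarith)
    have ht₁R : |t₁ l| ≤ R := by
      have h1 : |t l| ≤ Bt := hBt l hl
      have h2 := hclose l hl
      have h3 := abs_add_le (t l) (t₁ l - t l)
      rw [add_sub_cancel] at h3
      linarith
    obtain ⟨ha, hb, hU', hU⟩ := hC (t l) (t₁ l) (q l) htR ht₁R ((hBq l hl).trans (by linarith))
    have hCs : C * |t₁ l - t l| ≤ C * s := by gcongr; exact hclose l hl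
    refine time_change_cost_le (E := E l) (B := B) (hAE l hl) ?_ ?_ hU (hU'.trans hCs)
      (hT0 l hl) ?_ (hE0 l hl) ?_ rfl ?_ hδ hδτ hδ1 hs0 hκ0.le hsκ
    · have h1 := H.a_nonneg (t l) (q l) (Q l)
      calc _ ≤ 1 / 2 * ((1 + C * |t₁ l - t l|) * a (t l) (q l) (Q l) (Q l)) := by
            gcongr; exact ha (Q l)
        _ ≤ 1 / 2 * ((1 + C * s) * a (t l) (q l) (Q l) (Q l)) := by gcongr
        _ = _ := by ring
    · refine (hb (Q l)).trans ?_
      have : ‖Q l‖ ≤ B := (hBQ l hl).trans (by linarith)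
      gcongr
    · exact (le_abs_self _).trans ((hBT l hl).trans (by linarith))
    · exact (le_abs_self _).trans ((hBE l hl).trans (by linarith))
    · intro hlt
      rcases le_max_iff.1 (hcTE l hl) with h | h
      · linarith
      · exact h
  have hmem := H.homogeneous_action_mem h (fun l _ => (ht₁d l).hasDerivWithinAt)
    hT₁c.continuousOn (fun l hl => (hcost l hl).1) (fun l _ => (hq l).hasDerivWithinAt)
    hQ.continuousOn
  rw [ht₁α, ht₁β] at hmem
  refine ⟨_, hmem, ?_⟩
  have hint : ContinuousOn (fun l => (1 / 2) * a (t₁ l) (q l) (Q l) (Q l) / T₁ l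
      + b (t₁ l) (q l) (Q l) - 𝒰 (t₁ l) (q l) * T₁ l) (uIcc α β) := by
    rw [uIcc_of_le h.le]
    refine ContinuousOn.sub (ContinuousOn.add (ContinuousOn.div ?_ hT₁c.continuousOn
      fun l hl => (hcost l hl).1.ne') ?_) ?_
    · exact (continuous_const.mul (H.continuous_a.comp
        (ht₁c.prodMk (hqc.prodMk hQ)))).continuousOn
    · exact (H.continuous_b.comp (ht₁c.prodMk (hqc.prodMk hQ))).continuousOn
    · exact ((H.continuous_U.comp (ht₁c.prodMk hqc)).mul hT₁c).continuousOn
  have hi1 := hY.intervalIntegrable (μ := volume) α β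
  have hi2 := (hpc.const_mul (c / δ - C)).intervalIntegrable (μ := volume) α β
  have hi3 : IntervalIntegrable (fun _ : ℝ => s * D) volume α β :=
    continuous_const.intervalIntegrable α β
  have hle := integral_mono_on h.le hint.intervalIntegrable ((hi1.sub hi2).add hi3)
    fun l hl => (hcost l hl).2
  rw [integral_add (hi1.sub hi2) hi3, integral_sub hi1 hi2, intervalIntegral.integral_const_mul,
    intervalIntegral.integral_const, smul_eq_mul, ← hs,
    integral_eq_sub_of_hasDerivAt (fun l _ => hy l) hi1] at hle
  have hgain : C + D * (β - α) ≤ c / δ := by rw [le_div_iff₀ hδ]; linarith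
  have := mul_nonneg (sub_nonneg.2 hgain) hs0
  nlinarith

namespace RegularLagrangian

variable {d : ℕ} {a : ℝ → (Fin d → ℝ) → (Fin d → ℝ) → (Fin d → ℝ) → ℝ}
  {b : ℝ → (Fin d → ℝ) → (Fin d → ℝ) → ℝ} {𝒰 : ℝ → (Fin d → ℝ) → ℝ}

/-- A C¹ curve in configuration space lifts to a causal curve along any C¹ monotone time function,
with constant slack `σ` in the last component of the velocity. -/
theorem exists_causal_lift (H : RegularLagrangian a b 𝒰) {t₀ t₁ α β σ I : ℝ}
    {q₀ q₁ : Fin d → ℝ} (htt : t₀ ≤ t₁) (hI : I ∈ actionSet a b 𝒰 t₀ t₁ q₀ q₁)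
    {t T : ℝ → ℝ} (ht : ∀ l, HasDerivAt t (T l) l) (hT : Continuous T) (htα : t α = t₀)
    (htβ : t β = t₁) (hmaps : MapsTo t (Icc α β) (Icc t₀ t₁)) (hT0 : ∀ l ∈ Icc α β, 0 ≤ T l)
    (hσ : 0 ≤ σ) (hpos : ∀ l ∈ Icc α β, 0 < T l ∨ 0 < σ) (y₀ : ℝ) :
    ∃ x x' : ℝ → ℝ × (Fin d → ℝ) × ℝ, CausalCurveB a b 𝒰 x x' α β ∧ x α = (t₀, q₀, y₀) ∧
      x β = (t₁, q₁, y₀ + I + σ * (β - α)) ∧ ∀ l, T l = 0 → x' l = (0, 0, σ) := by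
  obtain ⟨q, q', hq, hq'c, hq₀, hq₁, hI⟩ := hI
  have hqc : ContinuousOn q (Icc t₀ t₁) := fun s hs => (hq s hs).continuousWithinAt
  have hLc := H.continuousOn_lag hqc hq'c
  obtain ⟨F, hF, hF0, hF1⟩ := exists_primitive htt hLc
  have htc : ContinuousOn t (Icc α β) := fun l _ => (ht l).continuousAt.continuousWithinAt
  refine ⟨fun l => (t l, q (t l), y₀ + F (t l) + σ * (l - α)),
    fun l => (T l, T l • q' (t l), T l * classicalLag a b 𝒰 (t l) (q (t l)) (q' (t l)) + σ),
    ⟨fun l hl => ?_, ?_, fun l hl => ?_⟩, by simp [htα, hq₀, hF0],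
    by simp [htβ, hq₁, hF1, hI], fun l hl => by simp [hl]⟩
  · have h1 := (ht l).hasDerivWithinAt (s := Icc α β)
    have h2 := (hq (t l) (hmaps hl)).scomp l h1 hmaps
    have h3 := (hF (t l) (hmaps hl)).scomp l h1 hmaps
    have h4 := (((hasDerivAt_id l).sub_const α).const_mul σ).hasDerivWithinAt (s := Icc α β)
    rw [mul_one] at h4
    exact h1.prodMk (h2.prodMk ((h3.const_add y₀).add h4))
  · exact hT.continuousOn.prodMk ((hT.continuousOn.smul (hq'c.comp htc hmaps)).prodMk
      ((hT.continuousOn.mul (hLc.comp htc hmaps)).add continuousOn_const))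
  · constructor
    · simp only [barG, classicalLag, H.a_smul, H.b_smul]
      have := mul_nonneg (hT0 l hl) hσ
      linarith
    · rcases (hT0 l hl).lt_or_eq with h | h
      · exact Or.inl h
      · right
        rcases hpos l hl with h' | h'
        · exact absurd h h'.ne
        · simpa [← h] using h'

theorem mem_JplusB_of_action_le (H : RegularLagrangian a b 𝒰) {t₀ t₁ y₀ y₁ I : ℝ}
    {q₀ q₁ : Fin d → ℝ} (htt : t₀ < t₁) (hI : I ∈ actionSet a b 𝒰 t₀ t₁ q₀ q₁)
    (hle : I ≤ y₁ - y₀) : (t₁, q₁, y₁) ∈ JplusB a b 𝒰 (t₀, q₀, y₀) := by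
  have hΔ : 0 < t₁ - t₀ := sub_pos.2 htt
  obtain ⟨x, x', hx, hx0, hx1, -⟩ := H.exists_causal_lift htt.le hI (t := fun l => l)
    (T := fun _ => 1) (σ := (y₁ - y₀ - I) / (t₁ - t₀)) (fun l => hasDerivAt_id l)
    continuous_const rfl rfl (mapsTo_id _) (fun _ _ => zero_le_one)
    (div_nonneg (by linarith) hΔ.le) (fun _ _ => Or.inl one_pos) y₀
  refine Or.inr ⟨t₀, t₁, x, x', htt, hx, hx0, ?_⟩
  rw [hx1, div_mul_cancel₀ _ hΔ.ne']
  congr 2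
  ring

theorem mem_JplusB_vertical (H : RegularLagrangian a b 𝒰) {t y₀ y₁ : ℝ} {q : Fin d → ℝ}
    (hy : y₀ ≤ y₁) : (t, q, y₁) ∈ JplusB a b 𝒰 (t, q, y₀) := by
  rcases hy.eq_or_lt with rfl | hy
  · exact Or.inl rfl
  · refine Or.inr ⟨y₀, y₁, fun l => (t, q, l), fun _ => (0, 0, 1), hy, ⟨fun l _ => ?_,
      continuousOn_const, fun l _ => ?_⟩, rfl, rfl⟩
    · exact (hasDerivWithinAt_const _ _ _).prodMk
        ((hasDerivWithinAt_const _ _ _).prodMk (hasDerivWithinAt_id _ _))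
    · simp [FDCausalB, barG, H.a_zero]

/-- The causal future in terms of the classical action. -/
theorem mem_JplusB_iff (H : RegularLagrangian a b 𝒰) {t₀ t₁ y₀ y₁ : ℝ} {q₀ q₁ : Fin d → ℝ} :
    (t₁, q₁, y₁) ∈ JplusB a b 𝒰 (t₀, q₀, y₀) ↔
      (t₀ < t₁ ∧ ∃ I ∈ actionSet a b 𝒰 t₀ t₁ q₀ q₁, I ≤ y₁ - y₀) ∨
      (t₀ = t₁ ∧ q₀ = q₁ ∧ y₀ ≤ y₁) := by
  constructor
  · rintro (h | ⟨α, β, x, x', h, ⟨hx, hx'c, hcausal⟩, hx0, hx1⟩)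
    · simp only [Prod.mk.injEq] at h
      exact Or.inr ⟨h.1.symm, h.2.1.symm, h.2.2.ge⟩
    obtain ⟨X, X', hX'c, hX, hXx, hX'⟩ := exists_global_C1_extension h.le hx hx'c
    have hα := hXx α (left_mem_Icc.2 h.le)
    have hβ := hXx β (right_mem_Icc.2 h.le)
    rw [hx0] at hα
    rw [hx1] at hβ
    have hc : ∀ l ∈ Icc α β, FDCausalB a b 𝒰 (X l) (X' l) := fun l hl => by
      rw [hXx l hl, hX', projIcc_of_mem h.le hl]
      exact hcausal l hl
    have ht : ∀ l, HasDerivAt (fun l => (X l).1) (X' l).1 l := fun l => (hX l).fst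
    have hq : ∀ l, HasDerivAt (fun l => (X l).2.1) (X' l).2.1 l := fun l => (hX l).snd.fst
    have hy : ∀ l, HasDerivAt (fun l => (X l).2.2) (X' l).2.2 l := fun l => (hX l).snd.snd
    have hT0 : ∀ l ∈ Icc α β, 0 ≤ (X' l).1 := fun l hl => by
      rcases (hc l hl).2 with h | h
      · exact h.le
      · exact h.1.ge
    have hmono : MonotoneOn (fun l => (X l).1) (Icc α β) := by
      refine monotoneOn_of_deriv_nonneg (convex_Icc α β)
        (fun l _ => (ht l).continuousAt.continuousWithinAt)
        (fun l _ => (ht l).differentiableAt.differentiableWithinAt) fun l hl => ?_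
      rw [(ht l).deriv]
      exact hT0 l (interior_subset hl)
    have hle : t₀ ≤ t₁ := by
      have := hmono (left_mem_Icc.2 h.le) (right_mem_Icc.2 h.le) h.le
      simpa [hα, hβ] using this
    rcases hle.lt_or_eq with hlt | rfl
    · left
      have := H.exists_action_le h ht hq hy hX'c.fst hX'c.snd.fst hX'c.snd.snd hc
        (by simpa [hα, hβ] using hlt)
      simp only [hα, hβ] at this
      exact ⟨hlt, this⟩
    · right
      have hconst : ∀ l ∈ Icc α β, (X l).1 = t₀ := fun l hl => by
        have h1 := hmono (left_mem_Icc.2 h.le) hl hl.1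
        have h2 := hmono hl (right_mem_Icc.2 h.le) hl.2
        simp only [hα, hβ] at h1 h2
        exact le_antisymm h2 h1
      have hT : ∀ l ∈ Ioo α β, (X' l).1 = 0 := fun l hl => by
        refine (ht l).unique ((hasDerivAt_const l t₀).congr_of_eventuallyEq ?_)
        filter_upwards [Icc_mem_nhds hl.1 hl.2] with s hs using hconst s hs
      have hQ : ∀ l ∈ Ioo α β, (X' l).2.1 = 0 := fun l hl => by
        by_contra hne
        have h1 := H.a_pos (X l).1 (X l).2.1 _ hne
        have h2 := (hc l (Ioo_subset_Icc_self hl)).1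
        simp only [barG, hT l hl] at h2
        linarith
      have hY : ∀ l ∈ Ioo α β, 0 < (X' l).2.2 := fun l hl => by
        rcases (hc l (Ioo_subset_Icc_self hl)).2 with h | h
        · exact absurd (hT l hl) h.ne'
        · exact h.2
      refine ⟨rfl, ?_, ?_⟩
      · have := constant_of_has_deriv_right_zero (f := fun l => (X l).2.1) (a := α) (b := β)
          (fun l _ => (hq l).continuousAt.continuousWithinAt) (fun l hl => ?_) β
          (right_mem_Icc.2 h.le)
        · simpa [hα, hβ] using this.symm
        · have h0 : (X' l).2.1 = 0 := by
            have hcl : IsClosed {l | (X' l).2.1 = 0} :=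
              isClosed_eq hX'c.snd.fst continuous_const
            have : closure (Ioo α β) ⊆ {l | (X' l).2.1 = 0} := hcl.closure_subset_iff.2 hQ
            rw [closure_Ioo h.ne] at this
            exact this (Ico_subset_Icc_self hl)
          have := (hq l).hasDerivWithinAt (s := Ici l)
          rwa [h0] at this
      · have : MonotoneOn (fun l => (X l).2.2) (Icc α β) := by
          refine monotoneOn_of_deriv_nonneg (convex_Icc α β)
            (fun l _ => (hy l).continuousAt.continuousWithinAt)
            (fun l _ => (hy l).differentiableAt.differentiableWithinAt) fun l hl => ?_
          rw [(hy l).deriv]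
          rw [interior_Icc] at hl
          exact (hY l hl).le
        have := this (left_mem_Icc.2 h.le) (right_mem_Icc.2 h.le) h.le
        simpa [hα, hβ] using this
  · rintro (⟨htt, I, hI, hle⟩ | ⟨rfl, rfl, hle⟩)
    · exact H.mem_JplusB_of_action_le htt hI hle
    · exact H.mem_JplusB_vertical hle

end RegularLagrangian

/-- A C¹ monotone time function whose derivative vanishes at both endpoints. -/
theorem exists_smooth_step {t₀ t₁ : ℝ} (htt : t₀ ≤ t₁) (α : ℝ) :
    ∃ t T : ℝ → ℝ, (∀ l, HasDerivAt t (T l) l) ∧ Continuous T ∧ t α = t₀ ∧ t (α + 1) = t₁ ∧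
      MapsTo t (Icc α (α + 1)) (Icc t₀ t₁) ∧ (∀ l ∈ Icc α (α + 1), 0 ≤ T l) ∧
      T α = 0 ∧ T (α + 1) = 0 := by
  have hΔ : 0 ≤ t₁ - t₀ := sub_nonneg.2 htt
  refine ⟨fun l => t₀ + (t₁ - t₀) * (3 * (l - α) ^ 2 - 2 * (l - α) ^ 3),
    fun l => (t₁ - t₀) * (6 * ((l - α) * (1 - (l - α)))), fun l => ?_, by fun_prop,
    by simp, by ring, fun l hl => ?_, fun l hl => ?_, by simp, by simp⟩
  · have h1 := (hasDerivAt_id' l).sub_const α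
    have := (((h1.pow 2).const_mul 3).sub ((h1.pow 3).const_mul 2)).const_mul (t₁ - t₀)
    exact (this.const_add t₀).congr_deriv (by push_cast; ring)
  · have h0 : 0 ≤ l - α := by linarith [hl.1]
    have h1 : 0 ≤ 1 - (l - α) := by linarith [hl.2]
    have h2 : 0 ≤ 3 * (l - α) ^ 2 - 2 * (l - α) ^ 3 := by
      have : 0 ≤ (l - α) ^ 2 * (1 + 2 * (1 - (l - α))) := by positivity
      linarith
    have h3 : 0 ≤ 1 - (3 * (l - α) ^ 2 - 2 * (l - α) ^ 3) := by
      have : 0 ≤ (1 - (l - α)) ^ 2 * (1 + 2 * (l - α)) := by positivity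
      linarith
    exact ⟨by have := mul_nonneg hΔ h2; simp only; linarith,
      by have := mul_nonneg hΔ h3; simp only; linarith⟩
  · have h0 : 0 ≤ l - α := by linarith [hl.1]
    have h1 : 0 ≤ 1 - (l - α) := by linarith [hl.2]
    positivity

namespace RegularLagrangian

variable {d : ℕ} {a : ℝ → (Fin d → ℝ) → (Fin d → ℝ) → (Fin d → ℝ) → ℝ}
  {b : ℝ → (Fin d → ℝ) → (Fin d → ℝ) → ℝ} {𝒰 : ℝ → (Fin d → ℝ) → ℝ}

/-- Two C¹ curves can be concatenated in spacetime at an arbitrarily small cost. -/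
theorem mem_JplusB_concat (H : RegularLagrangian a b 𝒰) {t₀ t₁ t₂ y₀ I₁ I₂ ε : ℝ}
    {q₀ q₁ q₂ : Fin d → ℝ} (h₁ : t₀ ≤ t₁) (h₂ : t₁ ≤ t₂)
    (hI₁ : I₁ ∈ actionSet a b 𝒰 t₀ t₁ q₀ q₁) (hI₂ : I₂ ∈ actionSet a b 𝒰 t₁ t₂ q₁ q₂)
    (hε : 0 < ε) : (t₂, q₂, y₀ + I₁ + I₂ + ε) ∈ JplusB a b 𝒰 (t₀, q₀, y₀) := by
  obtain ⟨s, S, hs, hSc, hs0, hs1, hsm, hS0, -, hS1⟩ := exists_smooth_step h₁ 0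
  obtain ⟨u, V, hu, hVc, hu0, hu1, hum, hV0, hV1, -⟩ := exists_smooth_step h₂ (0 + 1)
  have hσ : 0 < ε / 2 := half_pos hε
  obtain ⟨x, x', ⟨hx, hxc, hxf⟩, hx0, hx1, hxv⟩ := H.exists_causal_lift h₁ hI₁ hs hSc hs0 hs1 hsm
    hS0 hσ.le (fun _ _ => Or.inr hσ) y₀
  obtain ⟨z, z', ⟨hz, hzc, hzf⟩, hz0, hz1, hzv⟩ := H.exists_causal_lift h₂ hI₂ hu hVc hu0 hu1 hum
    hV0 hσ.le (fun _ _ => Or.inr hσ) (y₀ + I₁ + ε / 2 * (0 + 1 - 0))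
  have hxz : x (0 + 1) = z (0 + 1) := by rw [hx1, hz0]
  have hxz' : x' (0 + 1) = z' (0 + 1) := by rw [hxv _ hS1, hzv _ hV1]
  refine Or.inr ⟨0, 0 + 1 + 1, _, _, by norm_num, ⟨hasDerivWithinAt_glue (by norm_num)
    (by norm_num) hx hz hxz hxz', continuousOn_glue hxc hzc hxz', fun l hl => ?_⟩, ?_, ?_⟩
  · by_cases h : l ≤ 0 + 1
    · simp only [if_pos h]
      exact hxf l ⟨hl.1, h⟩
    · simp only [if_neg h]
      exact hzf l ⟨(not_le.1 h).le, hl.2⟩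
  · rw [if_pos (by norm_num), hx0]
  · rw [if_neg (by norm_num), hz1]
    congr 2
    ring

/-- Transitivity of the causal relation, when causal futures are closed. -/
theorem JplusB_trans (H : RegularLagrangian a b 𝒰) {m₀ m₁ m₂ : ℝ × (Fin d → ℝ) × ℝ}
    (hcl : IsClosed (JplusB a b 𝒰 m₀)) (h₁ : m₁ ∈ JplusB a b 𝒰 m₀)
    (h₂ : m₂ ∈ JplusB a b 𝒰 m₁) : m₂ ∈ JplusB a b 𝒰 m₀ := by
  obtain ⟨t₀, q₀, y₀⟩ := m₀
  obtain ⟨t₁, q₁, y₁⟩ := m₁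
  obtain ⟨t₂, q₂, y₂⟩ := m₂
  rcases H.mem_JplusB_iff.1 h₁ with ⟨ht₁, I₁, hI₁, hle₁⟩ | ⟨rfl, rfl, hle₁⟩
  · rcases H.mem_JplusB_iff.1 h₂ with ⟨ht₂, I₂, hI₂, hle₂⟩ | ⟨rfl, rfl, hle₂⟩
    · have htend : Tendsto (fun ε : ℝ => (t₂, q₂, y₂ + ε)) (𝓝[>] 0) (𝓝 (t₂, q₂, y₂)) := by
        have : Continuous fun ε : ℝ => (t₂, q₂, y₂ + ε) := by fun_prop
        simpa using (this.tendsto 0).mono_left (nhdsWithin_le_nhds (s := Ioi 0))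
      refine hcl.mem_of_tendsto htend ?_
      filter_upwards [self_mem_nhdsWithin] with ε (hε : 0 < ε)
      have := H.mem_JplusB_concat (y₀ := y₀) ht₁.le ht₂.le hI₁ hI₂
        (ε := y₂ + ε - y₀ - I₁ - I₂) (by linarith)
      convert this using 3
      ring
    · exact H.mem_JplusB_iff.2 (Or.inl ⟨ht₁, I₁, hI₁, by linarith⟩)
  · rcases H.mem_JplusB_iff.1 h₂ with ⟨ht₂, I₂, hI₂, hle₂⟩ | ⟨rfl, rfl, hle₂⟩
    · exact H.mem_JplusB_iff.2 (Or.inl ⟨ht₂, I₂, hI₂, by linarith⟩)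
    · exact H.mem_JplusB_iff.2 (Or.inr ⟨rfl, rfl, by linarith⟩)

/-- Every point is a limit of points whose causal future contains a neighbourhood of it. -/
theorem exists_mem_JplusB_of_near (H : RegularLagrangian a b 𝒰) (t : ℝ) (q : Fin d → ℝ) :
    ∃ C : ℝ, 0 ≤ C ∧ ∀ y δ t₁ q₁ y₁, 0 < δ → δ ≤ 1 → |t₁ - t| < δ / 2 → ‖q₁ - q‖ < δ / 2 →
      |y₁ - y| < δ → (t₁, q₁, y₁) ∈ JplusB a b 𝒰 (t - δ, q, y - (2 * C + 1) * δ) := by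
  obtain ⟨C, hC⟩ := (isCompact_closedBall (0 : ℝ × (Fin d → ℝ) × (Fin d → ℝ))
    (|t| + ‖q‖ + 2)).exists_bound_of_continuousOn H.continuous_lag.continuousOn
  have hC0 : 0 ≤ C := (norm_nonneg _).trans
    (hC 0 (Metric.mem_closedBall_self (by positivity)))
  refine ⟨C, hC0, fun y δ t₁ q₁ y₁ hδ hδ1 ht hq hy => ?_⟩
  rw [abs_lt] at ht hy
  have hD : δ / 2 < t₁ - (t - δ) := by linarith [ht.1]
  have hD0 : 0 < t₁ - (t - δ) := by linarith
  set v := (t₁ - (t - δ))⁻¹ • (q₁ - q) with hv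
  have hvD : (t₁ - (t - δ)) • v = q₁ - q := smul_inv_smul₀ hD0.ne' _
  have hv1 : ‖v‖ ≤ 1 := by
    rw [hv, norm_smul, norm_inv, Real.norm_of_nonneg hD0.le, inv_mul_le_iff₀ hD0]
    linarith
  have hpath : Continuous fun s : ℝ => q + (s - (t - δ)) • v := by fun_prop
  refine H.mem_JplusB_of_action_le (I := ∫ s in (t - δ)..t₁,
    classicalLag a b 𝒰 s (q + (s - (t - δ)) • v) v) (by linarith)
    ⟨fun s => q + (s - (t - δ)) • v, fun _ => v, fun s _ => ?_, continuousOn_const, by simp,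
      by simp [hvD], rfl⟩ ?_
  · have := (((hasDerivAt_id' s).sub_const (t - δ)).smul_const v).const_add q
    rw [one_smul] at this
    exact this.hasDerivWithinAt
  · have hLc : Continuous fun s => classicalLag a b 𝒰 s (q + (s - (t - δ)) • v) v :=
      H.continuous_lag.comp (continuous_id.prodMk (hpath.prodMk continuous_const))
    have hint : ∫ s in (t - δ)..t₁, classicalLag a b 𝒰 s (q + (s - (t - δ)) • v) v ≤
        ∫ _ in (t - δ)..t₁, C := by
      refine integral_mono_on (by linarith) (hLc.intervalIntegrable _ _)
        (continuous_const.intervalIntegrable _ _) fun s hs => ?_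
      refine (le_abs_self _).trans (hC (s, q + (s - (t - δ)) • v, v) ?_)
      have hs0 : 0 ≤ s - (t - δ) := by linarith [hs.1]
      have hnq := norm_nonneg q
      have hnt := abs_nonneg t
      simp only [mem_closedBall_zero_iff, Prod.norm_def, sup_le_iff]
      refine ⟨?_, ?_, by linarith⟩
      · rw [Real.norm_eq_abs, abs_le]
        have h1 := neg_abs_le t
        have h2 := le_abs_self t
        exact ⟨by linarith [hs.1], by linarith [hs.2, ht.2]⟩
      · refine (norm_add_le _ _).trans ?_
        rw [norm_smul, Real.norm_of_nonneg hs0]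
        have : (s - (t - δ)) * ‖v‖ ≤ 2 * 1 :=
          mul_le_mul (by linarith [hs.2, ht.2]) hv1 (norm_nonneg v) zero_le_two
        linarith
    rw [intervalIntegral.integral_const, smul_eq_mul] at hint
    have : (t₁ - (t - δ)) * C ≤ (2 * δ) * C :=
      mul_le_mul_of_nonneg_right (by linarith [ht.2]) hC0
    linarith [hy.1]

/-- If all causal futures and pasts are closed then so is the causal relation. -/
theorem isClosed_causalRel (H : RegularLagrangian a b 𝒰)
    (hcl : ∀ m, IsClosed (JplusB a b 𝒰 m) ∧ IsClosed (JminusB a b 𝒰 m)) :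
    IsClosed {p : (ℝ × (Fin d → ℝ) × ℝ) × (ℝ × (Fin d → ℝ) × ℝ) | p.2 ∈ JplusB a b 𝒰 p.1} := by
  refine isClosed_of_closure_subset ?_
  rintro ⟨⟨t, q, y⟩, m⟩ hp
  obtain ⟨C, -, hC⟩ := H.exists_mem_JplusB_of_near t q
  have hmem : ∀ δ ∈ Ioc (0 : ℝ) 1, m ∈ JplusB a b 𝒰 (t - δ, q, y - (2 * C + 1) * δ) := by
    rintro δ ⟨hδ, hδ1⟩
    set r := (t - δ, q, y - (2 * C + 1) * δ) with hr
    rw [← (hcl r).1.closure_eq]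
    have hnear : ∀ᶠ p : ℝ × (Fin d → ℝ) × ℝ in 𝓝 (t, q, y), p ∈ JplusB a b 𝒰 r := by
      filter_upwards [Metric.ball_mem_nhds (t, q, y) (half_pos hδ)] with p hp
      rw [mem_ball_iff_norm, Prod.norm_def, max_lt_iff, Prod.norm_def, max_lt_iff] at hp
      exact hC y δ p.1 p.2.1 p.2.2 hδ hδ1 hp.1 hp.2.1 (hp.2.2.trans (half_lt_self hδ))
    rw [mem_closure_iff_frequently] at hp ⊢
    have hev : ∀ᶠ p : (ℝ × (Fin d → ℝ) × ℝ) × (ℝ × (Fin d → ℝ) × ℝ) in 𝓝 ((t, q, y), m),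
        p.1 ∈ JplusB a b 𝒰 r := (continuous_fst.tendsto ((t, q, y), m)).eventually hnear
    exact (continuous_snd.tendsto ((t, q, y), m)).frequently
      ((hp.and_eventually hev).mono fun p hp => H.JplusB_trans (hcl r).1 hp.2 hp.1)
  have htend : Tendsto (fun δ : ℝ => (t - δ, q, y - (2 * C + 1) * δ)) (𝓝[>] 0)
      (𝓝 (t, q, y)) := by
    have : Continuous fun δ : ℝ => (t - δ, q, y - (2 * C + 1) * δ) := by fun_prop
    simpa using (this.tendsto 0).mono_left (nhdsWithin_le_nhds (s := Ioi 0))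
  refine (hcl m).2.mem_of_tendsto htend ?_
  filter_upwards [Ioc_mem_nhdsGT one_pos] with δ hδ using hmem δ hδ

theorem mem_JplusB_iff_IfunB_le (H : RegularLagrangian a b 𝒰)
    (hmin : ∀ (t₀ t₁ : ℝ) (q₀ q₁ : Fin d → ℝ), t₀ < t₁ →
      IfunB a b 𝒰 (t₀, q₀) (t₁, q₁) ≠ ⊤ → IfunB a b 𝒰 (t₀, q₀) (t₁, q₁) ≠ ⊥ →
      ∃ I ∈ actionSet a b 𝒰 t₀ t₁ q₀ q₁, (I : EReal) = IfunB a b 𝒰 (t₀, q₀) (t₁, q₁))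
    {t₀ t₁ y₀ y₁ : ℝ} {q₀ q₁ : Fin d → ℝ} :
    (t₁, q₁, y₁) ∈ JplusB a b 𝒰 (t₀, q₀, y₀) ↔
      IfunB a b 𝒰 (t₀, q₀) (t₁, q₁) ≤ ((y₁ - y₀ : ℝ) : EReal) := by
  rw [H.mem_JplusB_iff]
  by_cases htt : t₀ < t₁
  · have hI : IfunB a b 𝒰 (t₀, q₀) (t₁, q₁) =
        sInf ((fun r : ℝ => (r : EReal)) '' actionSet a b 𝒰 t₀ t₁ q₀ q₁) := by
      simp [IfunB, htt]
    constructor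
    · rintro (⟨-, I, hI', hle⟩ | ⟨h, -⟩)
      · rw [hI]
        exact (sInf_le (mem_image_of_mem _ hI')).trans (EReal.coe_le_coe_iff.2 hle)
      · exact absurd h htt.ne
    · intro hle
      refine Or.inl ⟨htt, ?_⟩
      by_cases hbot : IfunB a b 𝒰 (t₀, q₀) (t₁, q₁) = ⊥
      · have : sInf ((fun r : ℝ => (r : EReal)) '' actionSet a b 𝒰 t₀ t₁ q₀ q₁) <
            ((y₁ - y₀ : ℝ) : EReal) := by
          rw [← hI, hbot]
          exact EReal.bot_lt_coe _
        obtain ⟨_, ⟨I, hI', rfl⟩, hlt⟩ := sInf_lt_iff.1 this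
        exact ⟨I, hI', (EReal.coe_lt_coe_iff.1 hlt).le⟩
      · obtain ⟨I, hI', hIeq⟩ := hmin t₀ t₁ q₀ q₁ htt
          (hle.trans_lt (EReal.coe_lt_top _)).ne hbot
        rw [← hIeq] at hle
        exact ⟨I, hI', EReal.coe_le_coe_iff.1 hle⟩
  · by_cases heq : t₀ = t₁ ∧ q₀ = q₁
    · have : ((0 : ℝ) : EReal) ≤ ((y₁ - y₀ : ℝ) : EReal) ↔ y₀ ≤ y₁ := by
        rw [EReal.coe_le_coe_iff, sub_nonneg]
      simpa [IfunB, heq] using this.symm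
    · have : ¬ (t₀ = t₁ ∧ q₀ = q₁ ∧ y₀ ≤ y₁) := fun h => heq ⟨h.1, h.2.1⟩
      simp [IfunB, htt, heq, this, -not_and, -EReal.coe_sub]

theorem exists_minimizer_of_isClosed (H : RegularLagrangian a b 𝒰) {t₀ t₁ : ℝ}
    {q₀ q₁ : Fin d → ℝ} (hcl : IsClosed (JplusB a b 𝒰 (t₀, q₀, 0))) (htt : t₀ < t₁)
    (htop : IfunB a b 𝒰 (t₀, q₀) (t₁, q₁) ≠ ⊤) (hbot : IfunB a b 𝒰 (t₀, q₀) (t₁, q₁) ≠ ⊥) :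
    ∃ I ∈ actionSet a b 𝒰 t₀ t₁ q₀ q₁, (I : EReal) = IfunB a b 𝒰 (t₀, q₀) (t₁, q₁) := by
  have hI : IfunB a b 𝒰 (t₀, q₀) (t₁, q₁) =
      sInf ((fun r : ℝ => (r : EReal)) '' actionSet a b 𝒰 t₀ t₁ q₀ q₁) := by
    simp [IfunB, htt]
  lift IfunB a b 𝒰 (t₀, q₀) (t₁, q₁) to ℝ using ⟨htop, hbot⟩ with r hr
  have hmem : (t₁, q₁, r) ∈ JplusB a b 𝒰 (t₀, q₀, 0) := by
    have htend : Tendsto (fun s : ℝ => (t₁, q₁, s)) (𝓝[>] r) (𝓝 (t₁, q₁, r)) := by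
      have : Continuous fun s : ℝ => (t₁, q₁, s) := by fun_prop
      exact (this.tendsto r).mono_left nhdsWithin_le_nhds
    refine hcl.mem_of_tendsto htend ?_
    filter_upwards [self_mem_nhdsWithin] with s (hs : r < s)
    have hlt : sInf ((fun r : ℝ => (r : EReal)) '' actionSet a b 𝒰 t₀ t₁ q₀ q₁) < (s : EReal) := by
      rw [← hI]
      exact EReal.coe_lt_coe_iff.2 hs
    obtain ⟨_, ⟨I, hI', rfl⟩, hlt⟩ := sInf_lt_iff.1 hlt
    exact H.mem_JplusB_of_action_le htt hI' (by linarith [EReal.coe_lt_coe_iff.1 hlt])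
  rcases H.mem_JplusB_iff.1 hmem with ⟨-, I, hI', hle⟩ | ⟨h, -⟩
  · refine ⟨I, hI', le_antisymm (EReal.coe_le_coe_iff.2 (by linarith)) ?_⟩
    rw [hI]
    exact sInf_le (mem_image_of_mem _ hI')
  · exact absurd h htt.ne

theorem lowerSemicontinuous_IfunB (H : RegularLagrangian a b 𝒰)
    (hcl : ∀ m, IsClosed (JplusB a b 𝒰 m) ∧ IsClosed (JminusB a b 𝒰 m)) :
    LowerSemicontinuous
      (fun p : (ℝ × (Fin d → ℝ)) × (ℝ × (Fin d → ℝ)) => IfunB a b 𝒰 p.1 p.2) := by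
  have hreal : ∀ r : ℝ, IsClosed {p : (ℝ × (Fin d → ℝ)) × (ℝ × (Fin d → ℝ)) |
      IfunB a b 𝒰 p.1 p.2 ≤ (r : EReal)} := by
    intro r
    have hcont : Continuous fun p : (ℝ × (Fin d → ℝ)) × (ℝ × (Fin d → ℝ)) =>
        ((p.1.1, p.1.2, (0 : ℝ)), (p.2.1, p.2.2, r)) := by fun_prop
    convert (H.isClosed_causalRel hcl).preimage hcont using 1
    ext p
    have := H.mem_JplusB_iff_IfunB_le (fun t₀ t₁ q₀ q₁ htt =>
      H.exists_minimizer_of_isClosed (hcl (t₀, q₀, 0)).1 htt) (t₀ := p.1.1) (t₁ := p.2.1)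
      (q₀ := p.1.2) (q₁ := p.2.2) (y₀ := 0) (y₁ := r)
    rw [sub_zero] at this
    exact this.symm
  rw [lowerSemicontinuous_iff_isClosed_preimage]
  intro c
  induction c with
  | top => simp
  | coe r => exact hreal r
  | bot =>
    have : (fun p : (ℝ × (Fin d → ℝ)) × (ℝ × (Fin d → ℝ)) => IfunB a b 𝒰 p.1 p.2) ⁻¹' Iic ⊥ =
        ⋂ r : ℝ, {p | IfunB a b 𝒰 p.1 p.2 ≤ (r : EReal)} := by
      ext p
      simp only [mem_preimage, mem_Iic, le_bot_iff, mem_iInter, mem_ofPred_eq]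
      exact ⟨fun h r => h ▸ bot_le, fun h => EReal.eq_bot_iff_forall_lt _ |>.2 fun r =>
        (h (r - 1)).trans_lt (EReal.coe_lt_coe_iff.2 (sub_one_lt r))⟩
    rw [this]
    exact isClosed_iInter hreal

theorem isClosed_causalRel_of_lowerSemicontinuous (H : RegularLagrangian a b 𝒰)
    (hlsc : LowerSemicontinuous
      (fun p : (ℝ × (Fin d → ℝ)) × (ℝ × (Fin d → ℝ)) => IfunB a b 𝒰 p.1 p.2))
    (hmin : ∀ (t₀ t₁ : ℝ) (q₀ q₁ : Fin d → ℝ), t₀ < t₁ →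
      IfunB a b 𝒰 (t₀, q₀) (t₁, q₁) ≠ ⊤ → IfunB a b 𝒰 (t₀, q₀) (t₁, q₁) ≠ ⊥ →
      ∃ I ∈ actionSet a b 𝒰 t₀ t₁ q₀ q₁, (I : EReal) = IfunB a b 𝒰 (t₀, q₀) (t₁, q₁)) :
    IsClosed {p : (ℝ × (Fin d → ℝ) × ℝ) × (ℝ × (Fin d → ℝ) × ℝ) | p.2 ∈ JplusB a b 𝒰 p.1} := by
  have hcont : Continuous fun p : (ℝ × (Fin d → ℝ) × ℝ) × (ℝ × (Fin d → ℝ) × ℝ) =>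
      (((p.1.1, p.1.2.1), (p.2.1, p.2.2.1)), ((p.2.2.2 - p.1.2.2 : ℝ) : EReal)) :=
    Continuous.prodMk (by fun_prop) (continuous_coe_real_ereal.comp (by fun_prop))
  convert hlsc.isClosed_epigraph.preimage hcont using 1
  ext p
  exact H.mem_JplusB_iff_IfunB_le hmin

end RegularLagrangian

/-- Causal simplicity of the Eisenhart spacetime is equivalent to: (i) lower
semicontinuity of the infimum `𝓘` of the classical action, together with (ii) the
existence of minimizers of the classical action whenever `𝓘` is finite
(the Bolza problem). -/
theorem causally_simple_iff_action_minimizers (d : ℕ) (hd : 1 ≤ d)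
    (a : ℝ → (Fin d → ℝ) → (Fin d → ℝ) → (Fin d → ℝ) → ℝ)
    (b : ℝ → (Fin d → ℝ) → (Fin d → ℝ) → ℝ)
    (𝒰 : ℝ → (Fin d → ℝ) → ℝ)
    (hsymm : ∀ t q v w, a t q v w = a t q w v)
    (halin : ∀ t q w, IsLinearMap ℝ (fun v => a t q v w))
    (hapos : ∀ t q v, v ≠ 0 → 0 < a t q v v)
    (hblin : ∀ t q, IsLinearMap ℝ (b t q))
    (hareg : ∀ v w, ContDiff ℝ 1 (fun p : ℝ × (Fin d → ℝ) => a p.1 p.2 v w))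
    (hbreg : ∀ v, ContDiff ℝ 1 (fun p : ℝ × (Fin d → ℝ) => b p.1 p.2 v))
    (hUreg : ContDiff ℝ 1 (fun p : ℝ × (Fin d → ℝ) => 𝒰 p.1 p.2)) :
    (∀ m : ℝ × (Fin d → ℝ) × ℝ,
        IsClosed (JplusB a b 𝒰 m) ∧ IsClosed (JminusB a b 𝒰 m)) ↔
    (LowerSemicontinuous
        (fun p : (ℝ × (Fin d → ℝ)) × (ℝ × (Fin d → ℝ)) => IfunB a b 𝒰 p.1 p.2) ∧
      ∀ (t₀ t₁ : ℝ) (q₀ q₁ : Fin d → ℝ), t₀ < t₁ →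
        IfunB a b 𝒰 (t₀, q₀) (t₁, q₁) ≠ ⊤ → IfunB a b 𝒰 (t₀, q₀) (t₁, q₁) ≠ ⊥ →
        ∃ q q' : ℝ → Fin d → ℝ,
          (∀ t ∈ Icc t₀ t₁, HasDerivWithinAt q (q' t) (Icc t₀ t₁) t) ∧
          ContinuousOn q' (Icc t₀ t₁) ∧ q t₀ = q₀ ∧ q t₁ = q₁ ∧
          ((∫ s in t₀..t₁, classicalLag a b 𝒰 s (q s) (q' s) : ℝ) : EReal)
            = IfunB a b 𝒰 (t₀, q₀) (t₁, q₁)) := by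
  have H := RegularLagrangian.of_bilinear hsymm halin hapos hblin hareg hbreg hUreg
  constructor
  · intro hcl
    refine ⟨H.lowerSemicontinuous_IfunB hcl, fun t₀ t₁ q₀ q₁ htt htop hbot => ?_⟩
    obtain ⟨I, ⟨q, q', hq, hq', h₀, h₁, rfl⟩, hI⟩ :=
      H.exists_minimizer_of_isClosed (hcl (t₀, q₀, 0)).1 htt htop hbot
    exact ⟨q, q', hq, hq', h₀, h₁, hI⟩
  · rintro ⟨hlsc, hmin⟩ m
    have hrel := H.isClosed_causalRel_of_lowerSemicontinuous hlsc
      fun t₀ t₁ q₀ q₁ htt htop hbot => by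
        obtain ⟨q, q', hq, hq', h₀, h₁, hI⟩ := hmin t₀ t₁ q₀ q₁ htt htop hbot
        exact ⟨_, ⟨q, q', hq, hq', h₀, h₁, rfl⟩, hI⟩
    exact ⟨hrel.preimage (Continuous.prodMk_right m), hrel.preimage (Continuous.prodMk_left m)⟩
end

section
/- (Regularity of minimizers.) Let r ≥ 1 and assume a, b, 𝒰 are of class C^r. Let t₀ < t₁ and suppose q̄ ∈ C¹([t₀,t₁],ℝ^d), with q̄(t₀) = q₀ and q̄(t₁) = q₁, attains the minimum of the classical action I over all C¹ curves from q₀ to q₁ on [t₀,t₁]. Then q̄ is of class C^{r+1}; in particular q̄ is C² and satisfies the Euler–Lagrange equations of the Lagrangian L(t,q,q̇) = ½·a(t,q)(q̇,q̇) + b(t,q)(q̇) − 𝒰(t,q). -/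
open Set

/-- Euler–Lagrange equations of a classical Lagrangian `L(t,q,q̇)` along a curve. -/
def SatisfiesELClassical {d : ℕ}
    (L : ℝ → (Fin d → ℝ) → (Fin d → ℝ) → ℝ) (q q' : ℝ → Fin d → ℝ) (s : Set ℝ) : Prop :=
  ∀ e : Fin d → ℝ, ∀ t ∈ s,
    HasDerivWithinAt (fun u => deriv (fun h : ℝ => L u (q u) (q' u + h • e)) 0)
      (deriv (fun h : ℝ => L t (q t + h • e) (q' t)) 0) s t

open MeasureTheory Filter Topology

/-- Differentiation under the integral sign over a compact interval, for jointly continuous data. -/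
theorem hasDerivAt_intervalIntegral_of_continuous {F F' : ℝ → ℝ → ℝ}
    (hF : Continuous (Function.uncurry F)) (hF' : Continuous (Function.uncurry F'))
    (hderiv : ∀ h s, HasDerivAt (fun k => F k s) (F' h s) h) (α β h₀ : ℝ) :
    HasDerivAt (fun h => ∫ s in α..β, F h s) (∫ s in α..β, F' h₀ s) h₀ := by
  have hcomp : IsCompact (Icc (h₀ - 1) (h₀ + 1) ×ˢ uIcc α β) := isCompact_Icc.prod isCompact_uIcc
  obtain ⟨C, hC⟩ := hcomp.exists_bound_of_continuousOn hF'.continuousOn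
  refine (intervalIntegral.hasDerivAt_integral_of_dominated_loc_of_deriv_le (F := F) (F' := F')
    (bound := fun _ => C) (Icc_mem_nhds (by linarith) (by linarith) : Icc (h₀ - 1) (h₀ + 1) ∈ 𝓝 h₀)
    ?_ ?_ ?_ ?_ ?_ ?_).2
  · exact Eventually.of_forall fun h =>
      (hF.comp (Continuous.prodMk_right h)).aestronglyMeasurable
  · exact (hF.comp (Continuous.prodMk_right h₀)).intervalIntegrable _ _
  · exact (hF'.comp (Continuous.prodMk_right h₀)).aestronglyMeasurable
  · exact Eventually.of_forall fun s hs h hh => hC (h, s) ⟨hh, uIoc_subset_uIcc hs⟩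
  · exact intervalIntegrable_const
  · exact Eventually.of_forall fun s _ h _ => hderiv h s

section FirstVariation

variable {E : Type*} [NormedAddCommGroup E] [NormedSpace ℝ E]

theorem hasDerivAt_lagrangian_line {L : ℝ × E × E → ℝ} (hL : Differentiable ℝ L)
    (s : ℝ) (x u η ζ : E) (h : ℝ) :
    HasDerivAt (fun k : ℝ => L (s, x + k • η, u + k • ζ))
      (fderiv ℝ L (s, x + h • η, u + h • ζ) (0, η, ζ)) h := by
  have hx (y e : E) : HasDerivAt (fun k : ℝ => y + k • e) e h := by
    simpa using ((hasDerivAt_id h).smul_const e).const_add y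
  exact (hL _).hasFDerivAt.comp_hasDerivAt h
    ((hasDerivAt_const h s).prodMk ((hx x η).prodMk (hx u ζ)))

/-- The first variation of a `C¹` Lagrangian action. -/
theorem hasDerivAt_action {L : ℝ × E × E → ℝ} (hL : ContDiff ℝ 1 L)
    {x u η ζ : ℝ → E} (hx : Continuous x) (hu : Continuous u) (hη : Continuous η)
    (hζ : Continuous ζ) (α β : ℝ) :
    HasDerivAt (fun h : ℝ => ∫ s in α..β, L (s, x s + h • η s, u s + h • ζ s))
      (∫ s in α..β, fderiv ℝ L (s, x s, u s) (0, η s, ζ s)) 0 := by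
  have hL' : Continuous (fderiv ℝ L) := hL.continuous_fderiv one_ne_zero
  have hLc : Continuous L := hL.continuous
  have := hasDerivAt_intervalIntegral_of_continuous
    (F := fun h s => L (s, x s + h • η s, u s + h • ζ s))
    (F' := fun h s => fderiv ℝ L (s, x s + h • η s, u s + h • ζ s) (0, η s, ζ s))
    (by simp only [Function.uncurry_def]; fun_prop)
    (by
      simp only [Function.uncurry_def]
      exact (hL'.comp (by fun_prop : Continuous fun p : ℝ × ℝ =>
        (p.2, x p.2 + p.1 • η p.2, u p.2 + p.1 • ζ p.2))).clm_apply (by fun_prop))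
    (fun h s => hasDerivAt_lagrangian_line (hL.differentiable one_ne_zero) s _ _ _ _ h) α β 0
  simpa using this

end FirstVariation

/-- The du Bois-Reymond lemma. -/
theorem hasDerivWithinAt_of_forall_integral_eq_zero {α β : ℝ} (hαβ : α < β) {P R : ℝ → ℝ}
    (hP : Continuous P) (hR : Continuous R)
    (hvar : ∀ φ φ' : ℝ → ℝ, (∀ t, HasDerivAt φ (φ' t) t) → Continuous φ' → φ α = 0 → φ β = 0 →
      ∫ s in α..β, (R s * φ s + P s * φ' s) = 0) :
    ∀ t ∈ Icc α β, HasDerivWithinAt P (R t) (Icc α β) t := by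
  set F : ℝ → ℝ := fun t => ∫ s in α..t, R s with hFdef
  have hF (t : ℝ) : HasDerivAt F (R t) t := hR.integral_hasStrictDerivAt α t |>.hasDerivAt
  have hFc : Continuous F := continuous_iff_continuousAt.2 fun t => (hF t).continuousAt
  set c : ℝ := (∫ s in α..β, (P s - F s)) / (β - α) with hc
  set ψ : ℝ → ℝ := fun s => P s - F s - c with hψdef
  have hψ : Continuous ψ := by fun_prop
  set φ : ℝ → ℝ := fun t => ∫ s in α..t, ψ s with hφdef
  have hφ (t : ℝ) : HasDerivAt φ (ψ t) t := hψ.integral_hasStrictDerivAt α t |>.hasDerivAt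
  have hφc : Continuous φ := continuous_iff_continuousAt.2 fun t => (hφ t).continuousAt
  have hφα : φ α = 0 := by simp [hφdef]
  have hφβ : φ β = 0 := by
    have : β - α ≠ 0 := by linarith
    simp only [hφdef, hψdef]
    rw [intervalIntegral.integral_sub
      (Continuous.intervalIntegrable (by fun_prop) _ _) intervalIntegrable_const, intervalIntegral.integral_const, hc, smul_eq_mul]
    field_simp
    ring
  have hvar := hvar φ ψ hφ hψ hφα hφβ
  have hparts : ∫ s in α..β, (R s * φ s + F s * ψ s) = 0 := by
    rw [intervalIntegral.integral_deriv_mul_eq_sub (fun t _ => hF t) (fun t _ => hφ t)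
      (hR.intervalIntegrable _ _) (hψ.intervalIntegrable _ _), hφα, hφβ]
    simp
  have hcψ : ∫ s in α..β, c * ψ s = 0 := by
    rw [intervalIntegral.integral_const_mul]
    change c * φ β = 0
    rw [hφβ, mul_zero]
  have hsq : ∫ s in α..β, ψ s ^ 2 = 0 := by
    have key : (fun s => ψ s ^ 2) = fun s =>
        (R s * φ s + P s * ψ s) - (R s * φ s + F s * ψ s) - c * ψ s := by
      funext s
      simp only [hψdef]
      ring
    rw [key, intervalIntegral.integral_sub, intervalIntegral.integral_sub, hvar, hparts, hcψ]
    · simp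
    all_goals exact Continuous.intervalIntegrable (by fun_prop) _ _
  have hzero : ∀ t ∈ Icc α β, ψ t = 0 := by
    intro t ht
    by_contra hne
    exact (intervalIntegral.integral_pos hαβ (hψ.pow 2).continuousOn (fun s _ => sq_nonneg (ψ s))
      ⟨t, ht, sq_pos_of_ne_zero hne⟩).ne' hsq
  have heq : ∀ t ∈ Icc α β, P t = F t + c := fun t ht => by
    have := hzero t ht
    simp only [hψdef] at this
    linarith
  exact fun t ht => ((hF t).add_const c).hasDerivWithinAt.congr heq (heq t ht)

section Regularity

variable {E F : Type*} [NormedAddCommGroup E] [NormedSpace ℝ E]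
  [NormedAddCommGroup F] [NormedSpace ℝ F]

theorem ContDiffOn.succ_of_hasDerivWithinAt {f f' : ℝ → E} {s : Set ℝ} {n : ℕ}
    (hs : UniqueDiffOn ℝ s) (hf : ∀ t ∈ s, HasDerivWithinAt f (f' t) s t)
    (hf' : ContDiffOn ℝ n f' s) : ContDiffOn ℝ (n + 1) f s := by
  rw [contDiffOn_succ_iff_derivWithin hs]
  exact ⟨fun t ht => (hf t ht).differentiableWithinAt, by simp,
    hf'.congr fun t ht => (hf t ht).derivWithin (hs t ht)⟩

theorem ContDiffOn.of_clm_apply_eq [FiniteDimensional ℝ E] {A : F → E →L[ℝ] E}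
    {u w : F → E} {s : Set F} {n : WithTop ℕ∞} (hA : ContDiffOn ℝ n A s)
    (hinj : ∀ t ∈ s, Function.Injective (A t)) (hw : ContDiffOn ℝ n w s)
    (h : ∀ t ∈ s, A t (u t) = w t) : ContDiffOn ℝ n u s := by
  have : CompleteSpace E := FiniteDimensional.complete ℝ E
  intro t ht
  have hequiv (t : F) (ht : t ∈ s) : ∃ e : E ≃L[ℝ] E, (e : E →L[ℝ] E) = A t :=
    ⟨(LinearEquiv.ofInjectiveEndo (A t : E →ₗ[ℝ] E) (hinj t ht)).toContinuousLinearEquiv, by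
      ext v; simp⟩
  have hinv : ContDiffWithinAt ℝ n (fun t => (A t).inverse) s t := by
    obtain ⟨e, he⟩ := hequiv t ht
    exact (he ▸ contDiffAt_map_inverse e : ContDiffAt ℝ n _ (A t)).comp_contDiffWithinAt t (hA t ht)
  refine (hinv.clm_apply (hw t ht)).congr_of_mem (fun y hy => ?_) ht
  obtain ⟨e, he⟩ := hequiv y hy
  rw [← h y hy, ← he, ContinuousLinearMap.inverse_equiv]
  simp

end Regularity

/-- If a curve `x` with continuous velocity `u` minimizes the action among `C¹` curves with the same
endpoints, then `∂L/∂v` is differentiable along it and the Euler–Lagrange equations hold. -/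
theorem hasDerivWithinAt_momentum_of_minimizer {E : Type*} [NormedAddCommGroup E]
    [NormedSpace ℝ E] {L : ℝ × E × E → ℝ} (hL : ContDiff ℝ 1 L) {x u : ℝ → E} {α β : ℝ}
    (hαβ : α < β) (hx : ∀ t, HasDerivAt x (u t) t) (hu : Continuous u)
    (hmin : ∀ y v : ℝ → E, (∀ t, HasDerivAt y (v t) t) → Continuous v → y α = x α → y β = x β →
      ∫ s in α..β, L (s, x s, u s) ≤ ∫ s in α..β, L (s, y s, v s))
    (e : E) : ∀ t ∈ Icc α β, HasDerivWithinAt (fun s => fderiv ℝ L (s, x s, u s) (0, 0, e))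
      (fderiv ℝ L (t, x t, u t) (0, e, 0)) (Icc α β) t := by
  have hxc : Continuous x := continuous_iff_continuousAt.2 fun t => (hx t).continuousAt
  have hL' : Continuous fun s => fderiv ℝ L (s, x s, u s) :=
    (hL.continuous_fderiv one_ne_zero).comp (by fun_prop)
  refine hasDerivWithinAt_of_forall_integral_eq_zero hαβ (hL'.clm_apply continuous_const)
    (hL'.clm_apply continuous_const) fun φ φ' hφ hφ' hφα hφβ => ?_
  have hφc : Continuous φ := continuous_iff_continuousAt.2 fun t => (hφ t).continuousAt
  have hder := hasDerivAt_action hL hxc hu (η := fun s => φ s • e) (ζ := fun s => φ' s • e)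
    (by fun_prop) (by fun_prop) α β
  have hlocal : IsLocalMin
      (fun h : ℝ => ∫ s in α..β, L (s, x s + h • φ s • e, u s + h • φ' s • e)) 0 := by
    refine Eventually.of_forall fun h => ?_
    simpa using hmin (fun s => x s + h • φ s • e) (fun s => u s + h • φ' s • e)
      (fun t => (hx t).add (((hφ t).smul_const e).const_smul h)) (by fun_prop)
      (by simp [hφα]) (by simp [hφβ])
  refine Eq.trans ?_ (hlocal.hasDerivAt_eq_zero hder)
  refine intervalIntegral.integral_congr fun s _ => ?_
  have : ((0 : ℝ), φ s • e, φ' s • e) = φ s • (0, e, 0) + φ' s • (0, 0, e) := by simp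
  simp only [this, map_add, map_smul, smul_eq_mul]
  ring

section Lagrangian

variable {d : ℕ} {a : ℝ → (Fin d → ℝ) → (Fin d → ℝ) → (Fin d → ℝ) → ℝ}
  {b : ℝ → (Fin d → ℝ) → (Fin d → ℝ) → ℝ} {𝒰 : ℝ → (Fin d → ℝ) → ℝ}

theorem IsLinearMap.apply_eq_sum_single {f : (Fin d → ℝ) → ℝ} (hf : IsLinearMap ℝ f)
    (v : Fin d → ℝ) : f v = ∑ i, v i * f (Pi.single i 1) := by
  conv_lhs => rw [pi_eq_sum_univ' v]
  exact (map_sum (IsLinearMap.mk' f hf) _ _).trans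
    (Finset.sum_congr rfl fun i _ => hf.map_smul (v i) _)

theorem isLinearMap_kinetic_right (hsymm : ∀ t q v w, a t q v w = a t q w v)
    (halin : ∀ t q w, IsLinearMap ℝ (fun v => a t q v w)) (t : ℝ) (q v : Fin d → ℝ) :
    IsLinearMap ℝ (a t q v) := by
  have : a t q v = fun w => a t q w v := funext fun w => hsymm t q v w
  exact this ▸ halin t q v

theorem contDiff_classicalLag {n : WithTop ℕ∞} (hsymm : ∀ t q v w, a t q v w = a t q w v)
    (halin : ∀ t q w, IsLinearMap ℝ (fun v => a t q v w))
    (hblin : ∀ t q, IsLinearMap ℝ (b t q))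
    (hareg : ∀ v w, ContDiff ℝ n (fun p : ℝ × (Fin d → ℝ) => a p.1 p.2 v w))
    (hbreg : ∀ v, ContDiff ℝ n (fun p : ℝ × (Fin d → ℝ) => b p.1 p.2 v))
    (hUreg : ContDiff ℝ n (fun p : ℝ × (Fin d → ℝ) => 𝒰 p.1 p.2)) :
    ContDiff ℝ n (fun p : ℝ × (Fin d → ℝ) × (Fin d → ℝ) =>
      classicalLag a b 𝒰 p.1 p.2.1 p.2.2) := by
  have hproj : ContDiff ℝ n (fun p : ℝ × (Fin d → ℝ) × (Fin d → ℝ) => (p.1, p.2.1)) := by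
    fun_prop
  have hcoord (i : Fin d) : ContDiff ℝ n
      (fun p : ℝ × (Fin d → ℝ) × (Fin d → ℝ) => p.2.2 i) := by fun_prop
  have ha : (fun p : ℝ × (Fin d → ℝ) × (Fin d → ℝ) => a p.1 p.2.1 p.2.2 p.2.2) = fun p =>
      ∑ i, p.2.2 i * ∑ j, p.2.2 j * a p.1 p.2.1 (Pi.single i 1) (Pi.single j 1) := by
    funext p
    rw [(halin p.1 p.2.1 p.2.2).apply_eq_sum_single]
    simp_rw [← (isLinearMap_kinetic_right hsymm halin p.1 p.2.1 _).apply_eq_sum_single p.2.2]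
  have hb : (fun p : ℝ × (Fin d → ℝ) × (Fin d → ℝ) => b p.1 p.2.1 p.2.2) = fun p =>
      ∑ i, p.2.2 i * b p.1 p.2.1 (Pi.single i 1) :=
    funext fun p => (hblin p.1 p.2.1).apply_eq_sum_single p.2.2
  refine ((contDiff_const.mul ?_).add ?_).sub (hUreg.comp hproj)
  · rw [ha]
    exact ContDiff.sum fun i _ => (hcoord i).mul
      (ContDiff.sum fun j _ => (hcoord j).mul ((hareg _ _).comp hproj))
  · rw [hb]
    exact ContDiff.sum fun i _ => (hcoord i).mul ((hbreg _).comp hproj)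

theorem hasDerivAt_classicalLag_velocity (hsymm : ∀ t q v w, a t q v w = a t q w v)
    (halin : ∀ t q w, IsLinearMap ℝ (fun v => a t q v w))
    (hblin : ∀ t q, IsLinearMap ℝ (b t q)) (t : ℝ) (q v e : Fin d → ℝ) :
    HasDerivAt (fun h : ℝ => classicalLag a b 𝒰 t q (v + h • e)) (a t q v e + b t q e) 0 := by
  have hexp : (fun h : ℝ => classicalLag a b 𝒰 t q (v + h • e)) = fun h =>
      classicalLag a b 𝒰 t q v + h * (a t q v e + b t q e) + h ^ 2 * (1 / 2 * a t q e e) := by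
    funext h
    have hl (w : Fin d → ℝ) : a t q (v + h • e) w = a t q v w + h * a t q e w := by
      simpa using ((halin t q w).map_add v (h • e)).trans
        (congrArg _ ((halin t q w).map_smul h e))
    simp only [classicalLag]
    rw [hl, hsymm t q v, hsymm t q e, hl, hl, (hblin t q).map_add, (hblin t q).map_smul,
      hsymm t q e v, smul_eq_mul]
    ring
  rw [hexp]
  refine HasDerivAt.congr_deriv ((((hasDerivAt_id (0 : ℝ)).mul_const (a t q v e + b t q e)).const_add
    (classicalLag a b 𝒰 t q v)).add (((hasDerivAt_id (0 : ℝ)).pow 2).mul_const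
      (1 / 2 * a t q e e))) ?_
  simp

/-- The operator `v ↦ (a(t,q)(v, eᵢ))ᵢ` representing the kinetic form. -/
noncomputable def kineticOperator (a : ℝ → (Fin d → ℝ) → (Fin d → ℝ) → (Fin d → ℝ) → ℝ)
    (p : ℝ × (Fin d → ℝ)) : (Fin d → ℝ) →L[ℝ] (Fin d → ℝ) :=
  ∑ i, ∑ j, a p.1 p.2 (Pi.single j 1) (Pi.single i 1) •
    (ContinuousLinearMap.proj (R := ℝ) (φ := fun _ : Fin d => ℝ) j).smulRight
      (Pi.single i 1 : Fin d → ℝ)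

theorem contDiff_kineticOperator {n : WithTop ℕ∞}
    (hareg : ∀ v w, ContDiff ℝ n (fun p : ℝ × (Fin d → ℝ) => a p.1 p.2 v w)) :
    ContDiff ℝ n (kineticOperator a) :=
  ContDiff.sum fun _ _ => ContDiff.sum fun _ _ => (hareg _ _).smul contDiff_const

theorem kineticOperator_apply (halin : ∀ t q w, IsLinearMap ℝ (fun v => a t q v w))
    (p : ℝ × (Fin d → ℝ)) (v : Fin d → ℝ) (i : Fin d) :
    kineticOperator a p v i = a p.1 p.2 v (Pi.single i 1) := by
  rw [(halin p.1 p.2 (Pi.single i 1)).apply_eq_sum_single v]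
  simp [kineticOperator, Finset.sum_apply, Pi.single_apply, mul_comm]

theorem kineticOperator_injective (hsymm : ∀ t q v w, a t q v w = a t q w v)
    (halin : ∀ t q w, IsLinearMap ℝ (fun v => a t q v w))
    (hapos : ∀ t q v, v ≠ 0 → 0 < a t q v v) (p : ℝ × (Fin d → ℝ)) :
    Function.Injective (kineticOperator a p) := by
  refine (injective_iff_map_eq_zero _).2 fun v hv => ?_
  by_contra hne
  refine (hapos p.1 p.2 v hne).ne' ?_
  rw [(isLinearMap_kinetic_right hsymm halin p.1 p.2 v).apply_eq_sum_single v]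
  simp [← kineticOperator_apply halin, hv]

end Lagrangian

/-- Regularity of minimizers of the classical action: if `a`, `b`, `𝒰` are `C^r`
(`r ≥ 1`) and a C¹ curve minimizes the classical action among C¹ curves with the
same endpoints, then it is `C^{r+1}`; in particular it is C² and satisfies the
Euler–Lagrange equations. -/
theorem minimizers_are_regular (d : ℕ) (hd : 1 ≤ d) (r : ℕ) (hr : 1 ≤ r)
    (a : ℝ → (Fin d → ℝ) → (Fin d → ℝ) → (Fin d → ℝ) → ℝ)
    (b : ℝ → (Fin d → ℝ) → (Fin d → ℝ) → ℝ)
    (𝒰 : ℝ → (Fin d → ℝ) → ℝ)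
    (hsymm : ∀ t q v w, a t q v w = a t q w v)
    (halin : ∀ t q w, IsLinearMap ℝ (fun v => a t q v w))
    (hapos : ∀ t q v, v ≠ 0 → 0 < a t q v v)
    (hblin : ∀ t q, IsLinearMap ℝ (b t q))
    (hareg : ∀ v w, ContDiff ℝ r (fun p : ℝ × (Fin d → ℝ) => a p.1 p.2 v w))
    (hbreg : ∀ v, ContDiff ℝ r (fun p : ℝ × (Fin d → ℝ) => b p.1 p.2 v))
    (hUreg : ContDiff ℝ r (fun p : ℝ × (Fin d → ℝ) => 𝒰 p.1 p.2))
    (t₀ t₁ : ℝ) (ht : t₀ < t₁) (q₀ q₁ : Fin d → ℝ)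
    (qbar qbar' : ℝ → Fin d → ℝ)
    (hqbar : ∀ t ∈ Icc t₀ t₁, HasDerivWithinAt qbar (qbar' t) (Icc t₀ t₁) t)
    (hqbarc : ContinuousOn qbar' (Icc t₀ t₁))
    (h0 : qbar t₀ = q₀) (h1 : qbar t₁ = q₁)
    (hmin : ∀ q q' : ℝ → Fin d → ℝ,
      (∀ t ∈ Icc t₀ t₁, HasDerivWithinAt q (q' t) (Icc t₀ t₁) t) →
      ContinuousOn q' (Icc t₀ t₁) → q t₀ = q₀ → q t₁ = q₁ →
      (∫ s in t₀..t₁, classicalLag a b 𝒰 s (qbar s) (qbar' s))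
        ≤ ∫ s in t₀..t₁, classicalLag a b 𝒰 s (q s) (q' s)) :
    ContDiffOn ℝ (r + 1) qbar (Icc t₀ t₁) ∧
    SatisfiesELClassical (classicalLag a b 𝒰) qbar qbar' (Icc t₀ t₁) := by
  have hE : UniqueDiffOn ℝ (Icc t₀ t₁) := uniqueDiffOn_Icc ht
  set L : ℝ × (Fin d → ℝ) × (Fin d → ℝ) → ℝ := fun p => classicalLag a b 𝒰 p.1 p.2.1 p.2.2
    with hLdef
  have hLr : ContDiff ℝ r L := contDiff_classicalLag hsymm halin hblin hareg hbreg hUreg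
  have hL : ContDiff ℝ 1 L := hLr.of_le (by exact_mod_cast hr)
  have hLd : Differentiable ℝ L := hL.differentiable one_ne_zero
  -- a global `C¹` extension of the minimizer
  set u : ℝ → Fin d → ℝ := IccExtend ht.le ((Icc t₀ t₁).domRestrict qbar') with hudef
  have hu : Continuous u := hqbarc.domRestrict.Icc_extend'
  have hueq : ∀ t ∈ Icc t₀ t₁, u t = qbar' t := fun t h => IccExtend_of_mem _ _ h
  set x : ℝ → Fin d → ℝ := fun t => qbar t₀ + ∫ s in t₀..t, u s with hxdef
  have hx (t : ℝ) : HasDerivAt x (u t) t :=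
    (hu.integral_hasStrictDerivAt t₀ t).hasDerivAt.const_add _
  have hxeq : ∀ t ∈ Icc t₀ t₁, x t = qbar t := by
    intro t h
    have hsub : Icc t₀ t ⊆ Icc t₀ t₁ := Icc_subset_Icc_right h.2
    have hFTC : ∫ s in t₀..t, u s = qbar t - qbar t₀ := by
      refine intervalIntegral.integral_eq_sub_of_hasDerivAt_of_le h.1
        (fun s hs => (hqbar s (hsub hs)).continuousWithinAt.mono hsub) (fun s hs => ?_)
        (hu.intervalIntegrable _ _)
      have hs' : s ∈ Ioo t₀ t₁ := ⟨hs.1, hs.2.trans_le h.2⟩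
      rw [hueq s (Ioo_subset_Icc_self hs')]
      exact (hqbar s (Ioo_subset_Icc_self hs')).hasDerivAt (Icc_mem_nhds hs'.1 hs'.2)
    simp [hxdef, hFTC]
  have hEL := hasDerivWithinAt_momentum_of_minimizer hL ht hx hu fun y v hy hv hy0 hy1 => by
    have hle := hmin y v (fun t _ => (hy t).hasDerivWithinAt) hv.continuousOn
      (by rw [hy0, hxeq t₀ (left_mem_Icc.2 ht.le), h0])
      (by rw [hy1, hxeq t₁ (right_mem_Icc.2 ht.le), h1])
    refine le_of_eq_of_le (intervalIntegral.integral_congr fun s hs => ?_) hle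
    rw [uIcc_of_le ht.le] at hs
    simp only [hLdef, hueq s hs, hxeq s hs]
  have hmomentum (t : ℝ) (q v e : Fin d → ℝ) :
      fderiv ℝ L (t, q, v) (0, 0, e) = a t q v e + b t q e := by
    have h := hasDerivAt_lagrangian_line hLd t q v 0 e 0
    simp only [smul_zero, zero_smul, add_zero] at h
    exact h.unique (hasDerivAt_classicalLag_velocity hsymm halin hblin t q v e)
  constructor
  · have hureg (n : ℕ) (hn : n ≤ r) : ContDiffOn ℝ n u (Icc t₀ t₁) := by
      induction n with
      | zero => exact contDiffOn_zero.2 hu.continuousOn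
      | succ n ih =>
        have hun := ih (by omega)
        have hxn : ContDiffOn ℝ (n + 1 : ℕ) x (Icc t₀ t₁) :=
          .succ_of_hasDerivWithinAt hE (fun t _ => (hx t).hasDerivWithinAt) hun
        have hforce (e : Fin d → ℝ) : ContDiffOn ℝ n
            (fun t => fderiv ℝ L (t, x t, u t) (0, e, 0)) (Icc t₀ t₁) := by
          have hL' : ContDiff ℝ n (fderiv ℝ L) := hLr.fderiv_right (by exact_mod_cast hn)
          exact (hL'.comp_contDiffOn (contDiffOn_id.prodMk
            ((hxn.of_le (by exact_mod_cast n.le_succ)).prodMk hun))).clm_apply contDiffOn_const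
        have hP (e : Fin d → ℝ) : ContDiffOn ℝ (n + 1 : ℕ)
            (fun t => fderiv ℝ L (t, x t, u t) (0, 0, e)) (Icc t₀ t₁) :=
          .succ_of_hasDerivWithinAt hE (hEL e) (hforce e)
        have hgraph : ContDiffOn ℝ (n + 1 : ℕ) (fun t => (t, x t)) (Icc t₀ t₁) :=
          contDiffOn_id.prodMk hxn
        have hn' : ((n + 1 : ℕ) : WithTop ℕ∞) ≤ r := by exact_mod_cast hn
        refine ContDiffOn.of_clm_apply_eq (A := fun t => kineticOperator a (t, x t))
          (w := fun t i => fderiv ℝ L (t, x t, u t) (0, 0, Pi.single i 1)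
            - b t (x t) (Pi.single i 1))
          (((contDiff_kineticOperator hareg).of_le hn').comp_contDiffOn hgraph)
          (fun t _ => kineticOperator_injective hsymm halin hapos _)
          (contDiffOn_pi.2 fun i => (hP _).sub
            (((hbreg _).of_le hn').comp_contDiffOn hgraph)) fun t _ => ?_
        funext i
        rw [kineticOperator_apply halin, hmomentum]
        simp
    exact .succ_of_hasDerivWithinAt hE hqbar
      ((hureg r le_rfl).congr fun t h => (hueq t h).symm)
  · intro e t h
    have hforce : deriv (fun k : ℝ => classicalLag a b 𝒰 t (qbar t + k • e) (qbar' t)) 0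
        = fderiv ℝ L (t, x t, u t) (0, e, 0) := by
      have h' := hasDerivAt_lagrangian_line hLd t (qbar t) (qbar' t) e 0 0
      simp only [smul_zero, zero_smul, add_zero] at h'
      rw [hxeq t h, hueq t h]
      exact h'.deriv
    have hP : ∀ s ∈ Icc t₀ t₁,
        deriv (fun k : ℝ => classicalLag a b 𝒰 s (qbar s) (qbar' s + k • e)) 0
          = fderiv ℝ L (s, x s, u s) (0, 0, e) := fun s hs => by
      rw [hmomentum, hxeq s hs, hueq s hs]
      exact (hasDerivAt_classicalLag_velocity hsymm halin hblin s _ _ e).deriv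
    rw [hforce]
    exact (hEL e t h).congr hP (hP t h)
end

section
/- Let w be an alternating trilinear form on ℝ^D such that for all indices α, β ∈ {0,…,D−1} one has Σ_{μ,ν=0}^{D−1} ε(μ)·ε(ν)·w_{αμν}·w_{βμν} = 0 (i.e. the Minkowski contraction w_{αμν} w_β{}^{μν}, obtained by raising two indices with η, vanishes as a 2-tensor). Then w = 0. -/
open Set

/-- If all components with a time index vanish, the diagonal Minkowski contraction of a
two-index array is a sum of squares, so its vanishing forces the array to vanish. -/
lemma eq_zero_of_minkowski_contraction_self_eq_zero {D : ℕ} (f : Fin D → Fin D → ℝ)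
    (hf : ∀ μ ν : Fin D, (μ : ℕ) = 0 ∨ (ν : ℕ) = 0 → f μ ν = 0)
    (hsum : ∑ μ : Fin D, ∑ ν : Fin D,
      (if (μ : ℕ) = 0 then (-1 : ℝ) else 1) * (if (ν : ℕ) = 0 then (-1 : ℝ) else 1)
        * f μ ν * f μ ν = 0) (μ ν : Fin D) : f μ ν = 0 := by
  have hsq : ∑ μ : Fin D, ∑ ν : Fin D, f μ ν ^ 2 = 0 := by
    rw [← hsum]
    refine Finset.sum_congr rfl fun μ _ => Finset.sum_congr rfl fun ν _ => ?_
    by_cases h : (μ : ℕ) = 0 ∨ (ν : ℕ) = 0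
    · simp [hf μ ν h]
    · push Not at h
      simp [h.1, h.2, sq]
  rw [Fintype.sum_eq_zero_iff_of_nonneg fun μ => Finset.sum_nonneg fun ν _ => sq_nonneg _] at hsq
  have hμ := congrFun hsq μ
  simp only [Pi.zero_apply] at hμ
  exact pow_eq_zero_iff two_ne_zero |>.1
    ((Finset.sum_eq_zero_iff_of_nonneg fun ν _ => sq_nonneg _).1 hμ ν (Finset.mem_univ ν))

/-- An alternating trilinear form on Minkowski `ℝ^D` whose contraction
`w_{αμν} w_β{}^{μν}` (indices raised with `η = diag(−1,1,…,1)`) vanishes as a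
2-tensor is identically zero. -/
theorem alternating_form_with_null_contraction_vanishes (D : ℕ) (hD : 1 ≤ D)
    (w : AlternatingMap ℝ (Fin D → ℝ) ℝ (Fin 3))
    (hw : ∀ α β : Fin D,
      ∑ μ : Fin D, ∑ ν : Fin D,
        (if (μ : ℕ) = 0 then (-1 : ℝ) else 1) * (if (ν : ℕ) = 0 then (-1 : ℝ) else 1)
          * w ![Pi.single α 1, Pi.single μ 1, Pi.single ν 1]
          * w ![Pi.single β 1, Pi.single μ 1, Pi.single ν 1] = 0) :
    w = 0 := by
  have swap₀₁ (x y z : Fin D → ℝ) : w ![x, y, z] = -w ![y, x, z] := by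
    rw [← w.map_swap ![y, x, z] (show (0 : Fin 3) ≠ 1 by decide)]
    congr 1; ext i; fin_cases i <;> rfl
  have swap₀₂ (x y z : Fin D → ℝ) : w ![x, y, z] = -w ![z, y, x] := by
    rw [← w.map_swap ![z, y, x] (show (0 : Fin 3) ≠ 2 by decide)]
    congr 1; ext i; fin_cases i <;> rfl
  have time (α μ ν : Fin D) (hα : (α : ℕ) = 0) :
      w ![Pi.single α 1, Pi.single μ 1, Pi.single ν 1] = 0 := by
    refine eq_zero_of_minkowski_contraction_self_eq_zero
      (fun μ ν => w ![Pi.single α 1, Pi.single μ 1, Pi.single ν 1]) ?_ (hw α α) μ ν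
    rintro μ ν (h | h)
    · obtain rfl : α = μ := Fin.ext (hα.trans h.symm)
      exact w.map_eq_zero_of_eq _ (i := 0) (j := 1) rfl (by decide)
    · obtain rfl : α = ν := Fin.ext (hα.trans h.symm)
      exact w.map_eq_zero_of_eq _ (i := 0) (j := 2) rfl (by decide)
  have components (α μ ν : Fin D) :
      w ![Pi.single α 1, Pi.single μ 1, Pi.single ν 1] = 0 := by
    refine eq_zero_of_minkowski_contraction_self_eq_zero
      (fun μ ν => w ![Pi.single α 1, Pi.single μ 1, Pi.single ν 1]) ?_ (hw α α) μ ν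
    rintro μ ν (h | h)
    · simp only [swap₀₁ (Pi.single α 1), time μ α ν h, neg_zero]
    · simp only [swap₀₂ (Pi.single α 1), time ν μ α h, neg_zero]
  refine Module.Basis.ext_alternating (Pi.basisFun ℝ (Fin D)) fun v _ => ?_
  rw [AlternatingMap.zero_apply, ← components (v 0) (v 1) (v 2)]
  congr 1
  ext i
  fin_cases i <;> simp
end

section
/- (The 1/μ-lift of a vector field.) Let V : M → ℝ × ℝ^d × ℝ be a C¹ vector field, V(x) = (τ(x), v(x), υ(x)), such that τ(x) > 0 everywhere (so that −g_x(n,V(x)) = ψ·τ > 0) and such that at every x the partial derivative ∂V/∂y(x) is a scalar multiple of n (V is a representative of a field on the quotient ℝ × ℝ^d; equivalently τ and v are independent of y). Then ∂V/∂y ≡ 0 if and only if the function x ↦ g_x(V(x),V(x)) is independent of y. Moreover, for fixed y-independent components τ > 0 and v, and for every prescribed continuous function ρ : ℝ × ℝ^d → ℝ, there is a unique y-independent component υ : ℝ × ℝ^d → ℝ such that g_x(V(x),V(x)) = ρ(t,q) for all x = (t,q,y); in particular, for every μ ∈ (0,∞] the 1/μ-lift, characterized by g_x(V,V) = −(ψ·τ)²/μ²,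 exists and is unique. -/
open Set

/-- The Eisenhart metric on `M = ℝ × (Fin d → ℝ) × ℝ`. -/
noncomputable def eisG {d : ℕ}
    (a : ℝ → (Fin d → ℝ) → (Fin d → ℝ) → (Fin d → ℝ) → ℝ)
    (b : ℝ → (Fin d → ℝ) → (Fin d → ℝ) → ℝ)
    (U ψ : ℝ → (Fin d → ℝ) → ℝ)
    (x V V' : ℝ × (Fin d → ℝ) × ℝ) : ℝ :=
  a x.1 x.2.1 V.2.1 V'.2.1
    - ψ x.1 x.2.1 * (V.1 * (V'.2.2 - b x.1 x.2.1 V'.2.1)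
        + V'.1 * (V.2.2 - b x.1 x.2.1 V.2.1))
    - (2 * U x.1 x.2.1 + 1) * (ψ x.1 x.2.1) ^ 2 * V.1 * V'.1

/-- The square of a vector under the Eisenhart metric is affine in its third component. -/
lemma eisG_self_eq {d : ℕ}
    (a : ℝ → (Fin d → ℝ) → (Fin d → ℝ) → (Fin d → ℝ) → ℝ)
    (b : ℝ → (Fin d → ℝ) → (Fin d → ℝ) → ℝ)
    (U ψ : ℝ → (Fin d → ℝ) → ℝ)
    (x : ℝ × (Fin d → ℝ) × ℝ) (τ : ℝ) (v : Fin d → ℝ) (υ : ℝ) :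
    eisG a b U ψ x (τ, v, υ) (τ, v, υ)
      = eisG a b U ψ x (τ, v, 0) (τ, v, 0) - 2 * (ψ x.1 x.2.1 * τ) * υ := by
  simp only [eisG]
  ring

/-- For fixed positive `τ` and fixed `v`, any prescribed value of `g(V,V)` is attained by a unique
`y`-independent third component. -/
lemma existsUnique_eisG_self_eq {d : ℕ}
    (a : ℝ → (Fin d → ℝ) → (Fin d → ℝ) → (Fin d → ℝ) → ℝ)
    (b : ℝ → (Fin d → ℝ) → (Fin d → ℝ) → ℝ)
    {U ψ : ℝ → (Fin d → ℝ) → ℝ} (hψ : ∀ t q, 0 < ψ t q)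
    {τ : ℝ → (Fin d → ℝ) → ℝ} (hτ : ∀ t q, 0 < τ t q)
    (v : ℝ → (Fin d → ℝ) → Fin d → ℝ) (ρ : ℝ → (Fin d → ℝ) → ℝ) :
    ∃! υ : ℝ → (Fin d → ℝ) → ℝ, ∀ (t : ℝ) (q : Fin d → ℝ) (y : ℝ),
      eisG a b U ψ (t, q, y) (τ t q, v t q, υ t q) (τ t q, v t q, υ t q) = ρ t q := by
  have hc : ∀ t q, 2 * (ψ t q * τ t q) ≠ 0 := fun t q =>
    (mul_pos two_pos (mul_pos (hψ t q) (hτ t q))).ne'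
  refine ⟨fun t q => (eisG a b U ψ (t, q, 0) (τ t q, v t q, 0) (τ t q, v t q, 0) - ρ t q)
    / (2 * (ψ t q * τ t q)), fun t q y => ?_, fun υ hυ => ?_⟩
  · rw [eisG_self_eq, mul_div_cancel₀ _ (hc t q)]
    simp only [eisG]
    ring
  · funext t q
    have h := hυ t q 0
    rw [eisG_self_eq] at h
    rw [eq_div_iff (hc t q)]
    linarith

/-- The `1/μ`-lift of a vector field: for a C¹ representative field `V` with
`τ > 0` whose `y`-derivative is everywhere proportional to `n = (0,0,1)`,
the `y`-derivative vanishes iff `g(V,V)` is independent of `y`; and for fixed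
`y`-independent components `τ > 0`, `v` and any prescribed continuous function
`ρ` there is a unique `y`-independent third component `υ` with `g(V,V) = ρ` —
in particular the `1/μ`-lift, characterized by `g(V,V) = −(ψτ)²/μ²`, exists and
is unique for every `μ ∈ (0,∞]`. -/
theorem one_over_mu_lift (d : ℕ) (hd : 1 ≤ d)
    (a : ℝ → (Fin d → ℝ) → (Fin d → ℝ) → (Fin d → ℝ) → ℝ)
    (b : ℝ → (Fin d → ℝ) → (Fin d → ℝ) → ℝ)
    (U ψ : ℝ → (Fin d → ℝ) → ℝ)
    (hsymm : ∀ t q v w, a t q v w = a t q w v)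
    (halin : ∀ t q w, IsLinearMap ℝ (fun v => a t q v w))
    (hapos : ∀ t q v, v ≠ 0 → 0 < a t q v v)
    (hblin : ∀ t q, IsLinearMap ℝ (b t q))
    (hψpos : ∀ t q, 0 < ψ t q)
    (hareg : ∀ v w, ContDiff ℝ 1 (fun p : ℝ × (Fin d → ℝ) => a p.1 p.2 v w))
    (hbreg : ∀ v, ContDiff ℝ 1 (fun p : ℝ × (Fin d → ℝ) => b p.1 p.2 v))
    (hUreg : ContDiff ℝ 1 (fun p : ℝ × (Fin d → ℝ) => U p.1 p.2))
    (hψreg : ContDiff ℝ 1 (fun p : ℝ × (Fin d → ℝ) => ψ p.1 p.2))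
    (V : (ℝ × (Fin d → ℝ) × ℝ) → ℝ × (Fin d → ℝ) × ℝ)
    (hV : ContDiff ℝ 1 V)
    (hτ : ∀ x, 0 < (V x).1)
    (hrep : ∀ x : ℝ × (Fin d → ℝ) × ℝ, ∃ c : ℝ,
      fderiv ℝ V x ((0, 0, 1) : ℝ × (Fin d → ℝ) × ℝ)
        = c • ((0, 0, 1) : ℝ × (Fin d → ℝ) × ℝ)) :
    ((∀ x : ℝ × (Fin d → ℝ) × ℝ,
        fderiv ℝ V x ((0, 0, 1) : ℝ × (Fin d → ℝ) × ℝ) = 0) ↔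
      (∀ (t : ℝ) (q : Fin d → ℝ) (y y' : ℝ),
        eisG a b U ψ (t, q, y) (V (t, q, y)) (V (t, q, y))
          = eisG a b U ψ (t, q, y') (V (t, q, y')) (V (t, q, y')))) ∧
    (∀ (τ : ℝ → (Fin d → ℝ) → ℝ) (v : ℝ → (Fin d → ℝ) → Fin d → ℝ),
      (∀ t q, 0 < τ t q) →
      ∀ ρ : ℝ → (Fin d → ℝ) → ℝ,
        Continuous (fun p : ℝ × (Fin d → ℝ) => ρ p.1 p.2) →
        ∃! υ : ℝ → (Fin d → ℝ) → ℝ, ∀ (t : ℝ) (q : Fin d → ℝ) (y : ℝ),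
          eisG a b U ψ (t, q, y) (τ t q, v t q, υ t q) (τ t q, v t q, υ t q)
            = ρ t q) ∧
    (∀ (τ : ℝ → (Fin d → ℝ) → ℝ) (v : ℝ → (Fin d → ℝ) → Fin d → ℝ),
      (∀ t q, 0 < τ t q) →
      ∀ μinv : ℝ, 0 ≤ μinv →
        ∃! υ : ℝ → (Fin d → ℝ) → ℝ, ∀ (t : ℝ) (q : Fin d → ℝ) (y : ℝ),
          eisG a b U ψ (t, q, y) (τ t q, v t q, υ t q) (τ t q, v t q, υ t q)
            = -(ψ t q * τ t q) ^ 2 * μinv ^ 2) := by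
  have hVy : ∀ t q y, HasDerivAt (fun y => V (t, q, y)) (fderiv ℝ V (t, q, y) (0, 0, 1)) y := by
    intro t q y
    have hline : HasDerivAt (fun y : ℝ => (t, q, y)) (0, 0, 1) y :=
      (hasDerivAt_const y t).prodMk ((hasDerivAt_const y q).prodMk (hasDerivAt_id y))
    exact ((hV.differentiable one_ne_zero (t, q, y)).hasFDerivAt).comp_hasDerivAt y hline
  have hconst : ∀ {E : Type} [NormedAddCommGroup E] [NormedSpace ℝ E] {f : ℝ → E},
      (∀ y, HasDerivAt f 0 y) → ∀ y y', f y = f y' := fun h =>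
    is_const_of_deriv_eq_zero (fun y => (h y).differentiableAt) fun y => (h y).deriv
  refine ⟨⟨fun h t q y y' => ?_, fun h => ?_⟩,
    fun τ v hτ ρ _ => existsUnique_eisG_self_eq a b hψpos hτ v ρ,
    fun τ v hτ μinv _ => existsUnique_eisG_self_eq a b hψpos hτ v _⟩
  · have hV_eq : V (t, q, y) = V (t, q, y') :=
      hconst (fun z => by simpa only [h] using hVy t q z) y y'
    rw [hV_eq]
    rfl
  · rintro ⟨t, q, y₀⟩
    have h1 : ∀ y, (V (t, q, y)).1 = (V (t, q, y₀)).1 := fun y =>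
      hconst (f := fun y => (V (t, q, y)).1) (fun z => by
        obtain ⟨c, hc⟩ := hrep (t, q, z)
        simpa [hc, Function.comp_def] using
          (ContinuousLinearMap.fst ℝ ℝ ((Fin d → ℝ) × ℝ)).hasFDerivAt.comp_hasDerivAt z
            (hVy t q z)) y y₀
    have h2 : ∀ y, (V (t, q, y)).2.1 = (V (t, q, y₀)).2.1 := fun y =>
      hconst (f := fun y => (V (t, q, y)).2.1) (fun z => by
        obtain ⟨c, hc⟩ := hrep (t, q, z)
        simpa [hc, Function.comp_def] using
          ((ContinuousLinearMap.fst ℝ (Fin d → ℝ) ℝ).comp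
            (ContinuousLinearMap.snd ℝ ℝ ((Fin d → ℝ) × ℝ))).hasFDerivAt.comp_hasDerivAt z
            (hVy t q z)) y y₀
    have hVconst : (fun y => V (t, q, y)) = fun _ => V (t, q, y₀) := by
      funext y
      have hy : V (t, q, y) = ((V (t, q, y₀)).1, (V (t, q, y₀)).2.1, (V (t, q, y)).2.2) :=
        Prod.ext (h1 y) (Prod.ext (h2 y) rfl)
      have hyy := h t q y y₀
      rw [hy, eisG_self_eq] at hyy
      have hz := eisG_self_eq a b U ψ (t, q, y₀) (V (t, q, y₀)).1 (V (t, q, y₀)).2.1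
        (V (t, q, y₀)).2.2
      have hmul : 2 * (ψ t q * (V (t, q, y₀)).1) * (V (t, q, y)).2.2
          = 2 * (ψ t q * (V (t, q, y₀)).1) * (V (t, q, y₀)).2.2 := by
        simp only [eisG] at hyy hz
        linarith
      have h3 := mul_left_cancel₀
        (mul_pos two_pos (mul_pos (hψpos t q) (hτ (t, q, y₀)))).ne' hmul
      exact Prod.ext (h1 y) (Prod.ext (h2 y) h3)
    have hderiv := hVy t q y₀
    rw [hVconst] at hderiv
    exact hderiv.unique (hasDerivAt_const y₀ _)
end
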